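/- arXiv:2209.12470 — 4 statements merged into one kernel-verified Lean document; each statement's English description precedes it below -/
import Mathlib

section
/- The quotient of the free k-algebra on generators a, b, c, d by the two-sided ideal generated by the H-relations is a 16-dimensional k-algebra; the images of the monomials a^e b^f c^g d^h with e, f, g, h ∈ {0,1} form a k-basis. -/
namespace Stmt1

/-- The four generators `a, b, c, d` of the algebra `H`. -/
inductive Gen | a | b | c | d

open Gen

variable (k : Type*) [Field k]

/-- The generators viewed inside the free algebra. -/
abbrev g (x : Gen) : FreeAlgebra k Gen := FreeAlgebra.ι k x

/-- The defining `H`-relations: `a² = b² = c² = 1`, `ab = ba`, `ac = ca`, `bc = cb`,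
`d² = a`, `da = ad`, `db = cd`, `dc = bd`. -/
inductive HRel : FreeAlgebra k Gen → FreeAlgebra k Gen → Prop
  | aa : HRel (g k a * g k a) 1
  | bb : HRel (g k b * g k b) 1
  | cc : HRel (g k c * g k c) 1
  | ab : HRel (g k a * g k b) (g k b * g k a)
  | ac : HRel (g k a * g k c) (g k c * g k a)
  | bc : HRel (g k b * g k c) (g k c * g k b)
  | dd : HRel (g k d * g k d) (g k a)
  | da : HRel (g k d * g k a) (g k a * g k d)
  | db : HRel (g k d * g k b) (g k c * g k d)
  | dc : HRel (g k d * g k c) (g k b * g k d)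

/-- The algebra `H`: the quotient of the free algebra on `a, b, c, d` by the two-sided
ideal generated by the `H`-relations. -/
abbrev HAlg := RingQuot (HRel k)

/-- The quotient map. -/
noncomputable abbrev mk : FreeAlgebra k Gen →ₐ[k] HAlg k := RingQuot.mkAlgHom k (HRel k)

/-- The image of the monomial `a^e * b^f * c^g * d^h` in `H`. -/
noncomputable def mono (e : Gen → Fin 2) : HAlg k :=
  mk k (g k a ^ (e a).val * g k b ^ (e b).val * g k c ^ (e c).val * g k d ^ (e d).val)

/-- The generators, enumerated. -/
def genEquivFin : Gen ≃ Fin 4 where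
  toFun
    | a => 0
    | b => 1
    | c => 2
    | d => 3
  invFun := ![a, b, c, d]
  left_inv x := by cases x <;> rfl
  right_inv i := by fin_cases i <;> rfl

instance : Fintype Gen := Fintype.ofEquiv _ genEquivFin.symm

instance : DecidableEq Gen := genEquivFin.decidableEq

/-- A faithful permutation representation of the group of order 16 presented by the
`H`-relations. -/
def perm : Gen → Equiv.Perm (Fin 8)
  | a => Equiv.swap 0 2 * Equiv.swap 1 3
  | b => Equiv.swap 4 5
  | c => Equiv.swap 6 7
  | d => Equiv.swap 0 1 * Equiv.swap 1 2 * Equiv.swap 2 3 * Equiv.swap 4 6 * Equiv.swap 5 7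

/-- The permutation represented by the monomial with exponents `e`. -/
def permMono (e : Gen → Fin 2) : Equiv.Perm (Fin 8) :=
  perm a ^ (e a).val * perm b ^ (e b).val * perm c ^ (e c).val * perm d ^ (e d).val

set_option maxRecDepth 10000 in
theorem permMono_apply_eq : ∀ p q r s : Fin 2,
    let σ := perm a ^ p.val * perm b ^ q.val * perm c ^ r.val * perm d ^ s.val
    σ 0 = ![![0, 1], ![2, 3]] p s ∧ σ 4 = ![![4, 5] q, ![6, 7] r] s ∧
      σ 6 = ![![6, 7] r, ![4, 5] q] s := by
  decide

theorem permMono_injective : Function.Injective permMono := by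
  have exponents_eq : ∀ p q r s p' q' r' s' : Fin 2,
      (![![0, 1], ![2, 3]] p s : Fin 8) = ![![0, 1], ![2, 3]] p' s' →
      (![![4, 5] q, ![6, 7] r] s : Fin 8) = ![![4, 5] q', ![6, 7] r'] s' →
      (![![6, 7] r, ![4, 5] q] s : Fin 8) = ![![6, 7] r', ![4, 5] q'] s' →
      p = p' ∧ q = q' ∧ r = r' ∧ s = s' := by
    decide
  intro e f h
  obtain ⟨h0, h4, h6⟩ := permMono_apply_eq (e a) (e b) (e c) (e d)
  obtain ⟨h0', h4', h6'⟩ := permMono_apply_eq (f a) (f b) (f c) (f d)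
  obtain ⟨ha, hb, hc, hd⟩ := exponents_eq _ _ _ _ _ _ _ _
    (h0.symm.trans ((DFunLike.congr_fun h 0).trans h0'))
    (h4.symm.trans ((DFunLike.congr_fun h 4).trans h4'))
    (h6.symm.trans ((DFunLike.congr_fun h 6).trans h6'))
  funext x
  cases x <;> assumption

/-- The representation of `H` in the group algebra of the symmetric group on 8 letters. -/
noncomputable def toPermAlgebra : HAlg k →ₐ[k] MonoidAlgebra k (Equiv.Perm (Fin 8)) :=
  RingQuot.liftAlgHom k ⟨FreeAlgebra.lift k fun x => MonoidAlgebra.of k _ (perm x), by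
    intro x y h
    cases h <;>
      simp only [g, map_mul, map_one, FreeAlgebra.lift_ι_apply] <;>
      simp only [← map_mul, ← map_one (MonoidAlgebra.of k (Equiv.Perm (Fin 8)))] <;>
      refine congrArg _ ?_ <;> decide⟩

theorem toPermAlgebra_mono (e : Gen → Fin 2) :
    toPermAlgebra k (mono k e) = MonoidAlgebra.of k _ (permMono e) := by
  simp only [toPermAlgebra, mono, mk, RingQuot.liftAlgHom_mkAlgHom_apply, g, map_mul, map_pow,
    FreeAlgebra.lift_ι_apply, permMono]

theorem linearIndependent_mono : LinearIndependent k (mono k) := by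
  refine LinearIndependent.of_comp (toPermAlgebra k).toLinearMap ?_
  have h : ⇑(toPermAlgebra k).toLinearMap ∘ mono k =
      ⇑(MonoidAlgebra.basis (Equiv.Perm (Fin 8)) k) ∘ permMono := by
    funext e
    simpa using toPermAlgebra_mono k e
  rw [h]
  exact (MonoidAlgebra.basis _ k).linearIndependent.comp _ permMono_injective

theorem mk_eq_of_hRel {x y : FreeAlgebra k Gen} (h : HRel k x y) : mk k x = mk k y :=
  RingQuot.mkAlgHom_rel k h

/-- Left multiplication by a generator permutes the monomials. -/
theorem mk_g_mul_mono_mem_range (x : Gen) (e : Gen → Fin 2) :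
    mk k (g k x) * mono k e ∈ Set.range (mono k) := by
  have haa := mk_eq_of_hRel k .aa
  have hbb := mk_eq_of_hRel k .bb
  have hcc := mk_eq_of_hRel k .cc
  have hba := (mk_eq_of_hRel k .ab).symm
  have hca := (mk_eq_of_hRel k .ac).symm
  have hcb := (mk_eq_of_hRel k .bc).symm
  have hdd := mk_eq_of_hRel k .dd
  have hda := mk_eq_of_hRel k .da
  have hdb := mk_eq_of_hRel k .db
  have hdc := mk_eq_of_hRel k .dc
  simp only [map_mul, map_one] at haa hbb hcc hba hca hcb hdd hda hdb hdc
  have left_assoc : ∀ {u v w : HAlg k}, u * v = w → ∀ z, u * (v * z) = w * z :=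
    fun h z => by rw [← mul_assoc, h]
  have hbaz := left_assoc hba
  have hcaz := left_assoc hca
  have hcbz := left_assoc hcb
  have haaz := left_assoc haa
  have hbbz := left_assoc hbb
  have hccz := left_assoc hcc
  have hdaz := left_assoc hda
  have hdbz := left_assoc hdb
  have hdcz := left_assoc hdc
  refine ⟨fun y => match x, y with
    | a, a => e a + 1
    | b, b => e b + 1
    | c, c => e c + 1
    | d, a => e a + e d
    | d, b => e c
    | d, c => e b
    | d, d => e d + 1
    | _, y => e y, ?_⟩
  obtain ⟨p, hp⟩ : ∃ p, e a = p := ⟨_, rfl⟩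
  obtain ⟨q, hq⟩ : ∃ q, e b = q := ⟨_, rfl⟩
  obtain ⟨r, hr⟩ : ∃ r, e c = r := ⟨_, rfl⟩
  obtain ⟨s, hs⟩ : ∃ s, e d = s := ⟨_, rfl⟩
  simp only [mono, map_mul, map_pow]
  cases x <;> simp only [hp, hq, hr, hs] <;> clear hp hq hr hs <;>
    fin_cases p <;> fin_cases q <;> fin_cases r <;> fin_cases s <;>
    simp [mul_assoc, haa, hbb, hcc, hba, hca, hcb, hdd, hda, hdb, hdc, hbaz, hcaz, hcbz,
      haaz, hbbz, hccz, hdaz, hdbz, hdcz]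

theorem mk_mul_mem_span_mono (x : FreeAlgebra k Gen) :
    ∀ y ∈ Submodule.span k (Set.range (mono k)),
      mk k x * y ∈ Submodule.span k (Set.range (mono k)) := by
  induction x with
  | grade0 r =>
    intro y hy
    rw [AlgHom.commutes, ← Algebra.smul_def]
    exact Submodule.smul_mem _ r hy
  | grade1 x =>
    intro y hy
    induction hy using Submodule.span_induction with
    | mem y hy =>
      obtain ⟨e, rfl⟩ := hy
      exact Submodule.subset_span (mk_g_mul_mono_mem_range k x e)
    | zero => simp
    | add y z _ _ hy hz => rw [mul_add]; exact Submodule.add_mem _ hy hz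
    | smul r y _ hy => rw [mul_smul_comm]; exact Submodule.smul_mem _ r hy
  | mul u v hu hv =>
    intro y hy
    rw [map_mul, mul_assoc]
    exact hu _ (hv _ hy)
  | add u v hu hv =>
    intro y hy
    rw [map_add, add_mul]
    exact Submodule.add_mem _ (hu y hy) (hv y hy)

theorem span_range_mono : Submodule.span k (Set.range (mono k)) = ⊤ := by
  refine eq_top_iff.2 fun x _ => ?_
  obtain ⟨x, rfl⟩ := RingQuot.mkAlgHom_surjective k (HRel k) x
  have one_mem : (1 : HAlg k) ∈ Submodule.span k (Set.range (mono k)) :=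
    Submodule.subset_span ⟨fun _ => 0, by simp [mono]⟩
  simpa using mk_mul_mem_span_mono k x 1 one_mem

theorem stmt1 [IsAlgClosed k] [CharZero k] :
    Module.finrank k (HAlg k) = 16 ∧
    LinearIndependent k (mono k) ∧
    Submodule.span k (Set.range (mono k)) = ⊤ := by
  refine ⟨?_, linearIndependent_mono k, span_range_mono k⟩
  rw [← finrank_top, ← span_range_mono k, finrank_span_eq_card (linearIndependent_mono k)]
  rfl

end Stmt1
end

section
/- There exists a Hopf algebra structure over k on the algebra H such that the comultiplication satisfies Δ(a) = a⊗a, Δ(b) = b⊗b, Δ(c) = c⊗c, Δ(d) = (1/2)[(1+bc)d ⊗ d + (1−bc)d ⊗ ad], the counit satisfies ε(a) = ε(b) = ε(c) = ε(d) = 1, and the antipode satisfies S(a) = a, S(b) = b, S(c) = c, S(d) = (1/2)[a(1+bc) + (1−bc)]d. -/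
namespace Stmt2

/-- The four generators `a, b, c, d` of the algebra `H`. -/
inductive Gen | a | b | c | d

open Gen TensorProduct

variable (k : Type*) [Field k]

/-- The generators viewed inside the free algebra. -/
abbrev g (x : Gen) : FreeAlgebra k Gen := FreeAlgebra.ι k x

/-- The defining `H`-relations: `a² = b² = c² = 1`, `ab = ba`, `ac = ca`, `bc = cb`,
`d² = a`, `da = ad`, `db = cd`, `dc = bd`. -/
inductive HRel : FreeAlgebra k Gen → FreeAlgebra k Gen → Prop
  | aa : HRel (g k a * g k a) 1
  | bb : HRel (g k b * g k b) 1
  | cc : HRel (g k c * g k c) 1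
  | ab : HRel (g k a * g k b) (g k b * g k a)
  | ac : HRel (g k a * g k c) (g k c * g k a)
  | bc : HRel (g k b * g k c) (g k c * g k b)
  | dd : HRel (g k d * g k d) (g k a)
  | da : HRel (g k d * g k a) (g k a * g k d)
  | db : HRel (g k d * g k b) (g k c * g k d)
  | dc : HRel (g k d * g k c) (g k b * g k d)

/-- The algebra `H`. -/
abbrev HAlg := RingQuot (HRel k)

/-- The quotient map. -/
noncomputable abbrev mk : FreeAlgebra k Gen →ₐ[k] HAlg k := RingQuot.mkAlgHom k (HRel k)

noncomputable abbrev A : HAlg k := mk k (g k a)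
noncomputable abbrev B : HAlg k := mk k (g k b)
noncomputable abbrev C : HAlg k := mk k (g k c)
noncomputable abbrev D : HAlg k := mk k (g k d)

section Relations

lemma A_mul_A : A k * A k = 1 := by
  simpa using RingQuot.mkAlgHom_rel k (HRel.aa (k := k))

lemma B_mul_B : B k * B k = 1 := by
  simpa using RingQuot.mkAlgHom_rel k (HRel.bb (k := k))

lemma C_mul_C : C k * C k = 1 := by
  simpa using RingQuot.mkAlgHom_rel k (HRel.cc (k := k))

lemma B_mul_A : B k * A k = A k * B k := by
  simpa using (RingQuot.mkAlgHom_rel k (HRel.ab (k := k))).symm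

lemma C_mul_A : C k * A k = A k * C k := by
  simpa using (RingQuot.mkAlgHom_rel k (HRel.ac (k := k))).symm

lemma C_mul_B : C k * B k = B k * C k := by
  simpa using (RingQuot.mkAlgHom_rel k (HRel.bc (k := k))).symm

lemma D_mul_D : D k * D k = A k := by
  simpa using RingQuot.mkAlgHom_rel k (HRel.dd (k := k))

lemma D_mul_A : D k * A k = A k * D k := by
  simpa using RingQuot.mkAlgHom_rel k (HRel.da (k := k))

lemma D_mul_B : D k * B k = C k * D k := by
  simpa using RingQuot.mkAlgHom_rel k (HRel.db (k := k))

lemma D_mul_C : D k * C k = B k * D k := by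
  simpa using RingQuot.mkAlgHom_rel k (HRel.dc (k := k))

lemma A_mul_A_mul (x : HAlg k) : A k * (A k * x) = x := by
  rw [← mul_assoc, A_mul_A, one_mul]

lemma B_mul_B_mul (x : HAlg k) : B k * (B k * x) = x := by
  rw [← mul_assoc, B_mul_B, one_mul]

lemma C_mul_C_mul (x : HAlg k) : C k * (C k * x) = x := by
  rw [← mul_assoc, C_mul_C, one_mul]

lemma B_mul_A_mul (x : HAlg k) : B k * (A k * x) = A k * (B k * x) := by
  rw [← mul_assoc, B_mul_A, mul_assoc]

lemma C_mul_A_mul (x : HAlg k) : C k * (A k * x) = A k * (C k * x) := by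
  rw [← mul_assoc, C_mul_A, mul_assoc]

lemma C_mul_B_mul (x : HAlg k) : C k * (B k * x) = B k * (C k * x) := by
  rw [← mul_assoc, C_mul_B, mul_assoc]

lemma D_mul_D_mul (x : HAlg k) : D k * (D k * x) = A k * x := by
  rw [← mul_assoc, D_mul_D]

lemma D_mul_A_mul (x : HAlg k) : D k * (A k * x) = A k * (D k * x) := by
  rw [← mul_assoc, D_mul_A, mul_assoc]

lemma D_mul_B_mul (x : HAlg k) : D k * (B k * x) = C k * (D k * x) := by
  rw [← mul_assoc, D_mul_B, mul_assoc]

lemma D_mul_C_mul (x : HAlg k) : D k * (C k * x) = B k * (D k * x) := by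
  rw [← mul_assoc, D_mul_C, mul_assoc]

end Relations

section Lift

variable {k}

/-- Four elements of a semiring satisfying the `H`-relations. -/
structure Relations {R : Type*} [Semiring R] (a b c d : R) : Prop where
  aa : a * a = 1
  bb : b * b = 1
  cc : c * c = 1
  ab : a * b = b * a
  ac : a * c = c * a
  bc : b * c = c * b
  dd : d * d = a
  da : d * a = a * d
  db : d * b = c * d
  dc : d * c = b * d

/-- The universal property of `H`: an algebra map out of `H` is given by four elements satisfying
the `H`-relations. -/
noncomputable def lift {R : Type*} [Semiring R] [Algebra k R] {a b c d : R}
    (h : Relations a b c d) : HAlg k →ₐ[k] R :=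
  RingQuot.liftAlgHom k ⟨FreeAlgebra.lift k (fun x => Gen.casesOn x a b c d), by
    intro x y hxy
    cases hxy <;> simp [h.aa, h.bb, h.cc, h.ab, h.ac, h.bc, h.dd, h.da, h.db, h.dc]⟩

section

variable {R : Type*} [Semiring R] [Algebra k R] {a b c d : R} (h : Relations a b c d)

lemma lift_A : lift h (A k) = a := by simp [lift]

lemma lift_B : lift h (B k) = b := by simp [lift]

lemma lift_C : lift h (C k) = c := by simp [lift]

lemma lift_D : lift h (D k) = d := by simp [lift]

end

lemma algHom_ext {R : Type*} [Semiring R] [Algebra k R] {f₁ f₂ : HAlg k →ₐ[k] R}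
    (ha : f₁ (A k) = f₂ (A k)) (hb : f₁ (B k) = f₂ (B k))
    (hc : f₁ (C k) = f₂ (C k)) (hd : f₁ (D k) = f₂ (D k)) : f₁ = f₂ := by
  apply RingQuot.ringQuot_ext'
  apply FreeAlgebra.hom_ext
  funext x
  cases x
  exacts [ha, hb, hc, hd]

/-- Induction principle: `H` is generated as an algebra by `a, b, c, d`. -/
lemma induction_on {P : HAlg k → Prop} (scalar : ∀ r : k, P (algebraMap k _ r))
    (ha : P (A k)) (hb : P (B k)) (hc : P (C k)) (hd : P (D k))
    (add : ∀ x y, P x → P y → P (x + y)) (mul : ∀ x y, P x → P y → P (x * y))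
    (x : HAlg k) : P x := by
  obtain ⟨x, rfl⟩ := RingQuot.mkAlgHom_surjective k (HRel k) x
  induction x using FreeAlgebra.induction with
  | grade0 r => simpa using scalar r
  | grade1 x => cases x <;> assumption
  | mul x y hx hy => simpa using mul _ _ hx hy
  | add x y hx hy => simpa using add _ _ hx hy

end Lift

section Hopf

attribute [local simp] mul_assoc mul_add add_mul mul_sub sub_mul tmul_add add_tmul tmul_sub
  sub_tmul smul_add smul_sub smul_smul Algebra.TensorProduct.one_def A_mul_A A_mul_A_mul B_mul_B
  B_mul_B_mul C_mul_C C_mul_C_mul B_mul_A B_mul_A_mul C_mul_A C_mul_A_mul C_mul_B C_mul_B_mul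
  D_mul_D D_mul_D_mul D_mul_A D_mul_A_mul D_mul_B D_mul_B_mul D_mul_C D_mul_C_mul

/-- The image of `d` under the comultiplication. -/
noncomputable def comulD : HAlg k ⊗[k] HAlg k :=
  (2 : k)⁻¹ •
    (((1 + B k * C k) * D k) ⊗ₜ[k] D k + ((1 - B k * C k) * D k) ⊗ₜ[k] (A k * D k))

/-- The image of `d` under the antipode. -/
noncomputable def antipodeD : HAlg k :=
  (2 : k)⁻¹ • ((A k * (1 + B k * C k) + (1 - B k * C k)) * D k)

@[local simp] lemma tensor_sub_mul (x y z : HAlg k ⊗[k] HAlg k) :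
    (x - y) * z = x * z - y * z := _root_.sub_mul x y z

@[local simp] lemma tensor_mul_sub (x y z : HAlg k ⊗[k] HAlg k) :
    x * (y - z) = x * y - x * z := _root_.mul_sub x y z

@[local simp] lemma tensor_smul_mul (r : k) (x y : HAlg k ⊗[k] HAlg k) :
    r • x * y = r • (x * y) := Algebra.smul_mul_assoc r x y

@[local simp] lemma tensor_mul_smul (r : k) (x y : HAlg k ⊗[k] HAlg k) :
    x * r • y = r • (x * y) := Algebra.mul_smul_comm r x y

lemma relations_comul [CharZero k] :
    Relations (A k ⊗ₜ[k] A k) (B k ⊗ₜ[k] B k) (C k ⊗ₜ[k] C k) (comulD k) where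
  aa := by simp
  bb := by simp
  cc := by simp
  ab := by simp
  ac := by simp
  bc := by simp
  dd := by simp [comulD]; module
  da := by simp [comulD]
  db := by simp [comulD]
  dc := by simp [comulD]

/-- The comultiplication of `H`. -/
noncomputable def comul [CharZero k] : HAlg k →ₐ[k] HAlg k ⊗[k] HAlg k :=
  lift (relations_comul k)

lemma relations_counit : Relations (1 : k) 1 1 1 := by constructor <;> simp

/-- The counit of `H`. -/
noncomputable def counit : HAlg k →ₐ[k] k :=
  lift (relations_counit k)

open MulOpposite in
lemma relations_antipode [CharZero k] :
    Relations (op (A k)) (op (B k)) (op (C k)) (op (antipodeD k)) where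
  aa := congrArg op (by simp)
  bb := congrArg op (by simp)
  cc := congrArg op (by simp)
  ab := congrArg op (by simp)
  ac := congrArg op (by simp)
  bc := congrArg op (by simp)
  dd := congrArg op (by simp [antipodeD]; module)
  da := congrArg op (by simp [antipodeD])
  db := congrArg op (by simp [antipodeD])
  dc := congrArg op (by simp [antipodeD])

/-- The antipode of `H`, as an algebra map to the opposite algebra. -/
noncomputable def antipodeOp [CharZero k] : HAlg k →ₐ[k] (HAlg k)ᵐᵒᵖ :=
  lift (relations_antipode k)

/-- The antipode of `H`. -/
noncomputable def antipode [CharZero k] : HAlg k →ₗ[k] HAlg k :=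
  (MulOpposite.opLinearEquiv k).symm.toLinearMap.comp (antipodeOp k).toLinearMap

@[simp] lemma antipode_one [CharZero k] : antipode k 1 = 1 := by simp [antipode]

@[simp] lemma antipode_mul [CharZero k] (x y : HAlg k) :
    antipode k (x * y) = antipode k y * antipode k x := by simp [antipode]

@[simp] lemma antipode_A [CharZero k] : antipode k (A k) = A k :=
  congrArg MulOpposite.unop (lift_A (relations_antipode k))

@[simp] lemma antipode_B [CharZero k] : antipode k (B k) = B k :=
  congrArg MulOpposite.unop (lift_B (relations_antipode k))

@[simp] lemma antipode_C [CharZero k] : antipode k (C k) = C k :=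
  congrArg MulOpposite.unop (lift_C (relations_antipode k))

@[simp] lemma antipode_D [CharZero k] : antipode k (D k) = antipodeD k :=
  congrArg MulOpposite.unop (lift_D (relations_antipode k))

@[simp] lemma comul_A [CharZero k] : comul k (A k) = A k ⊗ₜ A k :=
  lift_A (relations_comul k)

@[simp] lemma comul_B [CharZero k] : comul k (B k) = B k ⊗ₜ B k :=
  lift_B (relations_comul k)

@[simp] lemma comul_C [CharZero k] : comul k (C k) = C k ⊗ₜ C k :=
  lift_C (relations_comul k)

@[simp] lemma comul_D [CharZero k] : comul k (D k) = comulD k :=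
  lift_D (relations_comul k)

@[simp] lemma counit_A : counit k (A k) = 1 :=
  lift_A (relations_counit k)

@[simp] lemma counit_B : counit k (B k) = 1 :=
  lift_B (relations_counit k)

@[simp] lemma counit_C : counit k (C k) = 1 :=
  lift_C (relations_counit k)

@[simp] lemma counit_D : counit k (D k) = 1 :=
  lift_D (relations_counit k)

lemma comulD_eq : comulD k = (2 : k)⁻¹ • (D k ⊗ₜ D k) + (2 : k)⁻¹ • ((B k * C k * D k) ⊗ₜ D k) +
    (2 : k)⁻¹ • (D k ⊗ₜ (A k * D k)) + (-2⁻¹ : k) • ((B k * C k * D k) ⊗ₜ (A k * D k)) := by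
  simp [comulD]
  module

lemma comul_coassoc [CharZero k] :
    (Algebra.TensorProduct.assoc k k k (HAlg k) (HAlg k) (HAlg k)).toAlgHom.comp
        ((Algebra.TensorProduct.map (comul k) (AlgHom.id k _)).comp (comul k)) =
      (Algebra.TensorProduct.map (AlgHom.id k _) (comul k)).comp (comul k) := by
  apply algHom_ext
  · simp
  · simp
  · simp
  · simp [comulD_eq, ← smul_tmul', -neg_smul]
    module

lemma counit_comul_left [CharZero k] :
    (Algebra.TensorProduct.lid k (HAlg k)).toAlgHom.comp
        ((Algebra.TensorProduct.map (counit k) (AlgHom.id k _)).comp (comul k)) =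
      AlgHom.id k _ := by
  apply algHom_ext
  · simp
  · simp
  · simp
  · simp [comulD]
    module

lemma counit_comul_right [CharZero k] :
    (Algebra.TensorProduct.rid k k (HAlg k)).toAlgHom.comp
        ((Algebra.TensorProduct.map (AlgHom.id k _) (counit k)).comp (comul k)) =
      AlgHom.id k _ := by
  apply algHom_ext
  · simp
  · simp
  · simp
  · simp [comulD]
    module

lemma mul_antipode_left_mul [CharZero k] {u : HAlg k ⊗[k] HAlg k} {r : k}
    (hu : LinearMap.mul' k _ (TensorProduct.map (antipode k) LinearMap.id u) = algebraMap k _ r)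
    (v : HAlg k ⊗[k] HAlg k) :
    LinearMap.mul' k _ (TensorProduct.map (antipode k) LinearMap.id (u * v)) =
      algebraMap k _ r * LinearMap.mul' k _ (TensorProduct.map (antipode k) LinearMap.id v) := by
  induction v with
  | zero => simp
  | add v w hv hw => simp only [mul_add, map_add, hv, hw]
  | tmul x y =>
    have key : LinearMap.mul' k _ (TensorProduct.map (antipode k) LinearMap.id (u * x ⊗ₜ[k] y)) =
        antipode k x *
          LinearMap.mul' k _ (TensorProduct.map (antipode k) LinearMap.id u) * y := by
      clear hu
      induction u with
      | zero => simp
      | add u w hu hw => simp only [add_mul, mul_add, map_add, hu, hw]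
      | tmul p q => simp
    rw [key, hu, ← Algebra.commutes]
    simp

lemma mul_antipode_right_mul [CharZero k] {v : HAlg k ⊗[k] HAlg k} {r : k}
    (hv : LinearMap.mul' k _ (TensorProduct.map LinearMap.id (antipode k) v) = algebraMap k _ r)
    (u : HAlg k ⊗[k] HAlg k) :
    LinearMap.mul' k _ (TensorProduct.map LinearMap.id (antipode k) (u * v)) =
      LinearMap.mul' k _ (TensorProduct.map LinearMap.id (antipode k) u) * algebraMap k _ r := by
  induction u with
  | zero => simp
  | add u w hu hw => simp only [add_mul, map_add, hu, hw]
  | tmul x y =>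
    have key : LinearMap.mul' k _ (TensorProduct.map LinearMap.id (antipode k) (x ⊗ₜ[k] y * v)) =
        x * LinearMap.mul' k _ (TensorProduct.map LinearMap.id (antipode k) v) *
          antipode k y := by
      clear hv
      induction v with
      | zero => simp
      | add u w hu hw => simp only [add_mul, mul_add, map_add, hu, hw]
      | tmul p q => simp
    rw [key, hv, mul_assoc, Algebra.commutes, ← mul_assoc]
    simp

lemma mul_antipode_left_comul [CharZero k] (x : HAlg k) :
    LinearMap.mul' k _ (TensorProduct.map (antipode k) LinearMap.id (comul k x)) =
      algebraMap k _ (counit k x) := by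
  induction x using induction_on with
  | scalar r => simp [Algebra.algebraMap_eq_smul_one]
  | ha => simp
  | hb => simp
  | hc => simp
  | hd =>
    simp [comulD, antipodeD]
    module
  | add x y hx hy => simp only [map_add, hx, hy]
  | mul x y hx hy => rw [map_mul, mul_antipode_left_mul k hx, hy, map_mul, map_mul]

lemma mul_antipode_right_comul [CharZero k] (x : HAlg k) :
    LinearMap.mul' k _ (TensorProduct.map LinearMap.id (antipode k) (comul k x)) =
      algebraMap k _ (counit k x) := by
  induction x using induction_on with
  | scalar r => simp [Algebra.algebraMap_eq_smul_one]
  | ha => simp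
  | hb => simp
  | hc => simp
  | hd =>
    simp [comulD, antipodeD]
    module
  | add x y hx hy => simp only [map_add, hx, hy]
  | mul x y hx hy => rw [map_mul, mul_antipode_right_mul k hy, hx, map_mul, map_mul]

end Hopf

/-- There is a Hopf algebra structure on the algebra `H`, i.e. algebra maps
`Δ : H → H ⊗ H` and `ε : H → k` which are coassociative and counital together with a linear
antipode `S` which is a two-sided convolution inverse of the identity, such that
`Δ(a) = a⊗a`, `Δ(b) = b⊗b`, `Δ(c) = c⊗c`,
`Δ(d) = (1/2)[(1+bc)d ⊗ d + (1−bc)d ⊗ ad]`, `ε(a) = ε(b) = ε(c) = ε(d) = 1`,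
`S(a) = a`, `S(b) = b`, `S(c) = c` and `S(d) = (1/2)[a(1+bc) + (1−bc)]d`. -/
theorem stmt2 [IsAlgClosed k] [CharZero k] :
    ∃ (Δ : HAlg k →ₐ[k] HAlg k ⊗[k] HAlg k) (ε : HAlg k →ₐ[k] k)
      (S : HAlg k →ₗ[k] HAlg k),
      -- coassociativity
      (TensorProduct.assoc k (HAlg k) (HAlg k) (HAlg k)).toLinearMap.comp
          ((TensorProduct.map Δ.toLinearMap LinearMap.id).comp Δ.toLinearMap)
        = (TensorProduct.map LinearMap.id Δ.toLinearMap).comp Δ.toLinearMap ∧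
      -- counit laws
      (TensorProduct.lid k (HAlg k)).toLinearMap.comp
          ((TensorProduct.map ε.toLinearMap LinearMap.id).comp Δ.toLinearMap)
        = LinearMap.id ∧
      (TensorProduct.rid k (HAlg k)).toLinearMap.comp
          ((TensorProduct.map LinearMap.id ε.toLinearMap).comp Δ.toLinearMap)
        = LinearMap.id ∧
      -- the antipode is a two-sided convolution inverse of the identity
      (LinearMap.mul' k (HAlg k)).comp
          ((TensorProduct.map S LinearMap.id).comp Δ.toLinearMap)
        = (Algebra.linearMap k (HAlg k)).comp ε.toLinearMap ∧
      (LinearMap.mul' k (HAlg k)).comp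
          ((TensorProduct.map LinearMap.id S).comp Δ.toLinearMap)
        = (Algebra.linearMap k (HAlg k)).comp ε.toLinearMap ∧
      -- values of the comultiplication
      Δ (A k) = A k ⊗ₜ[k] A k ∧
      Δ (B k) = B k ⊗ₜ[k] B k ∧
      Δ (C k) = C k ⊗ₜ[k] C k ∧
      Δ (D k) = (2 : k)⁻¹ •
        (((1 + B k * C k) * D k) ⊗ₜ[k] D k + ((1 - B k * C k) * D k) ⊗ₜ[k] (A k * D k)) ∧
      -- values of the counit
      ε (A k) = 1 ∧ ε (B k) = 1 ∧ ε (C k) = 1 ∧ ε (D k) = 1 ∧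
      -- values of the antipode
      S (A k) = A k ∧ S (B k) = B k ∧ S (C k) = C k ∧
      S (D k) = (2 : k)⁻¹ • ((A k * (1 + B k * C k) + (1 - B k * C k)) * D k) := by
  refine ⟨comul k, counit k, antipode k, ?_, ?_, ?_, ?_, ?_, comul_A k, comul_B k, comul_C k,
    comul_D k, counit_A k, counit_B k, counit_C k, counit_D k, antipode_A k, antipode_B k,
    antipode_C k, antipode_D k⟩
  · exact congrArg AlgHom.toLinearMap (comul_coassoc k)
  · exact congrArg AlgHom.toLinearMap (counit_comul_left k)
  · exact congrArg AlgHom.toLinearMap (counit_comul_right k)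
  · exact LinearMap.ext (mul_antipode_left_comul k)
  · exact LinearMap.ext (mul_antipode_right_comul k)

end Stmt2
end

section
/- For all n1,...,n8 ∈ ℕ with n1+...+n8 ≥ 1 and all matrices of parameters λ = (λ_{iℓ}) ∈ k^{n1×n4}, μ = (μ_{jk}) ∈ k^{n2×n3}, ν = (ν_{mr}) ∈ k^{n5×n8}, γ = (γ_{qs}) ∈ k^{n6×n7}, the algebra U_1(n1,...,n8; λ,μ,ν,γ) has dimension 2^{4+n1+...+n8} over k; a k-basis is given by the images of the products (∏_i A_i^{α_i})(∏_j B_j^{β_j})(∏_k C_k^{γ_k})(∏_ℓ D_ℓ^{δ_ℓ})(∏_m E_m^{ε_m})(∏_q F_q^{φ_q})(∏_s G_s^{σ_s})(∏_r H_r^{ρ_r}) a^e b^f c^g d^h with all exponents in {0,1} and factors taken in increasing index order. -/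
namespace Stmt3

/-- The generators `a, b, c, d` and the eight families `A, B, C, D, E, F, G, H`. -/
inductive Gen (n1 n2 n3 n4 n5 n6 n7 n8 : ℕ)
  | a | b | c | d
  | A (i : Fin n1) | B (j : Fin n2) | C (i : Fin n3) | D (l : Fin n4)
  | E (m : Fin n5) | F (q : Fin n6) | G (s : Fin n7) | H (r : Fin n8)

open Gen

variable (k : Type*) [Field k]
variable (xi : k) (n1 n2 n3 n4 n5 n6 n7 n8 : ℕ)
  (lam : Matrix (Fin n1) (Fin n4) k) (mu : Matrix (Fin n2) (Fin n3) k)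
  (nu : Matrix (Fin n5) (Fin n8) k) (gam : Matrix (Fin n6) (Fin n7) k)

/-- The generators viewed inside the free algebra. -/
abbrev g {n1 n2 n3 n4 n5 n6 n7 n8 : ℕ} (x : Gen n1 n2 n3 n4 n5 n6 n7 n8) :
    FreeAlgebra k (Gen n1 n2 n3 n4 n5 n6 n7 n8) :=
  FreeAlgebra.ι k x

/-- The defining relations of `U_1(n1,…,n8; λ,μ,ν,γ)`. -/
inductive Rel : FreeAlgebra k (Gen n1 n2 n3 n4 n5 n6 n7 n8) →
    FreeAlgebra k (Gen n1 n2 n3 n4 n5 n6 n7 n8) → Prop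
  -- H-relations
  | haa : Rel (g k a * g k a) 1
  | hbb : Rel (g k b * g k b) 1
  | hcc : Rel (g k c * g k c) 1
  | hab : Rel (g k a * g k b) (g k b * g k a)
  | hac : Rel (g k a * g k c) (g k c * g k a)
  | hbc : Rel (g k b * g k c) (g k c * g k b)
  | hdd : Rel (g k d * g k d) (g k a)
  | hda : Rel (g k d * g k a) (g k a * g k d)
  | hdb : Rel (g k d * g k b) (g k c * g k d)
  | hdc : Rel (g k d * g k c) (g k b * g k d)
  | aA (i : Fin n1) : Rel (g k a * g k (A i)) (-(g k (A i) * g k a))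
  | bA (i : Fin n1) : Rel (g k b * g k (A i)) (g k (A i) * g k b)
  | cA (i : Fin n1) : Rel (g k c * g k (A i)) (g k (A i) * g k c)
  | dA (i : Fin n1) : Rel (g k d * g k (A i)) (-(xi • (g k (A i) * g k d)))
  | aB (j : Fin n2) : Rel (g k a * g k (B j)) (-(g k (B j) * g k a))
  | bB (j : Fin n2) : Rel (g k b * g k (B j)) (g k (B j) * g k b)
  | cB (j : Fin n2) : Rel (g k c * g k (B j)) (g k (B j) * g k c)
  | dB (j : Fin n2) : Rel (g k d * g k (B j)) (xi • (g k (B j) * g k d))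
  | aC (i : Fin n3) : Rel (g k a * g k (C i)) (-(g k (C i) * g k a))
  | bC (i : Fin n3) : Rel (g k b * g k (C i)) (g k (C i) * g k b)
  | cC (i : Fin n3) : Rel (g k c * g k (C i)) (g k (C i) * g k c)
  | dC (i : Fin n3) : Rel (g k d * g k (C i)) (-(xi • (g k (C i) * g k d)))
  | aD (l : Fin n4) : Rel (g k a * g k (D l)) (-(g k (D l) * g k a))
  | bD (l : Fin n4) : Rel (g k b * g k (D l)) (g k (D l) * g k b)
  | cD (l : Fin n4) : Rel (g k c * g k (D l)) (g k (D l) * g k c)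
  | dD (l : Fin n4) : Rel (g k d * g k (D l)) (xi • (g k (D l) * g k d))
  | aE (m : Fin n5) : Rel (g k a * g k (E m)) (-(g k (E m) * g k a))
  | bE (m : Fin n5) : Rel (g k b * g k (E m)) (-(g k (E m) * g k b))
  | cE (m : Fin n5) : Rel (g k c * g k (E m)) (-(g k (E m) * g k c))
  | dE (m : Fin n5) : Rel (g k d * g k (E m)) (-(xi • (g k (E m) * g k d)))
  | aF (q : Fin n6) : Rel (g k a * g k (F q)) (-(g k (F q) * g k a))
  | bF (q : Fin n6) : Rel (g k b * g k (F q)) (-(g k (F q) * g k b))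
  | cF (q : Fin n6) : Rel (g k c * g k (F q)) (-(g k (F q) * g k c))
  | dF (q : Fin n6) : Rel (g k d * g k (F q)) (xi • (g k (F q) * g k d))
  | aG (s : Fin n7) : Rel (g k a * g k (G s)) (-(g k (G s) * g k a))
  | bG (s : Fin n7) : Rel (g k b * g k (G s)) (-(g k (G s) * g k b))
  | cG (s : Fin n7) : Rel (g k c * g k (G s)) (-(g k (G s) * g k c))
  | dG (s : Fin n7) : Rel (g k d * g k (G s)) (-(xi • (g k (G s) * g k d)))
  | aH (r : Fin n8) : Rel (g k a * g k (H r)) (-(g k (H r) * g k a))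
  | bH (r : Fin n8) : Rel (g k b * g k (H r)) (-(g k (H r) * g k b))
  | cH (r : Fin n8) : Rel (g k c * g k (H r)) (-(g k (H r) * g k c))
  | dH (r : Fin n8) : Rel (g k d * g k (H r)) (xi • (g k (H r) * g k d))
  | AA (i i' : Fin n1) : Rel (g k (A i) * g k (A i') + g k (A i') * g k (A i)) (0)
  | BB (i i' : Fin n2) : Rel (g k (B i) * g k (B i') + g k (B i') * g k (B i)) (0)
  | CC (i i' : Fin n3) : Rel (g k (C i) * g k (C i') + g k (C i') * g k (C i)) (0)
  | DD (i i' : Fin n4) : Rel (g k (D i) * g k (D i') + g k (D i') * g k (D i)) (0)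
  | EE (i i' : Fin n5) : Rel (g k (E i) * g k (E i') + g k (E i') * g k (E i)) (0)
  | FF (i i' : Fin n6) : Rel (g k (F i) * g k (F i') + g k (F i') * g k (F i)) (0)
  | GG (i i' : Fin n7) : Rel (g k (G i) * g k (G i') + g k (G i') * g k (G i)) (0)
  | HH (i i' : Fin n8) : Rel (g k (H i) * g k (H i') + g k (H i') * g k (H i)) (0)
  | AD (i : Fin n1) (i' : Fin n4) : Rel (g k (A i) * g k (D i') + g k (D i') * g k (A i)) (lam i i' • (1 - g k b * g k c))
  | BC (i : Fin n2) (i' : Fin n3) : Rel (g k (B i) * g k (C i') + g k (C i') * g k (B i)) (mu i i' • (1 - g k b * g k c))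
  | EH (i : Fin n5) (i' : Fin n8) : Rel (g k (E i) * g k (H i') + g k (H i') * g k (E i)) (nu i i' • (1 - g k b * g k c))
  | FG (i : Fin n6) (i' : Fin n7) : Rel (g k (F i) * g k (G i') + g k (G i') * g k (F i)) (gam i i' • (1 - g k b * g k c))
  | AB (i : Fin n1) (i' : Fin n2) : Rel (g k (A i) * g k (B i') + g k (B i') * g k (A i)) (0)
  | AC (i : Fin n1) (i' : Fin n3) : Rel (g k (A i) * g k (C i') + g k (C i') * g k (A i)) (0)
  | BD (i : Fin n2) (i' : Fin n4) : Rel (g k (B i) * g k (D i') + g k (D i') * g k (B i)) (0)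
  | CD (i : Fin n3) (i' : Fin n4) : Rel (g k (C i) * g k (D i') + g k (D i') * g k (C i)) (0)
  | EF (i : Fin n5) (i' : Fin n6) : Rel (g k (E i) * g k (F i') + g k (F i') * g k (E i)) (0)
  | EG (i : Fin n5) (i' : Fin n7) : Rel (g k (E i) * g k (G i') + g k (G i') * g k (E i)) (0)
  | FH (i : Fin n6) (i' : Fin n8) : Rel (g k (F i) * g k (H i') + g k (H i') * g k (F i)) (0)
  | GH (i : Fin n7) (i' : Fin n8) : Rel (g k (G i) * g k (H i') + g k (H i') * g k (G i)) (0)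
  | AE (i : Fin n1) (i' : Fin n5) : Rel (g k (A i) * g k (E i') - g k (E i') * g k (A i)) (0)
  | AF (i : Fin n1) (i' : Fin n6) : Rel (g k (A i) * g k (F i') - g k (F i') * g k (A i)) (0)
  | AG (i : Fin n1) (i' : Fin n7) : Rel (g k (A i) * g k (G i') - g k (G i') * g k (A i)) (0)
  | AH (i : Fin n1) (i' : Fin n8) : Rel (g k (A i) * g k (H i') - g k (H i') * g k (A i)) (0)
  | BE (i : Fin n2) (i' : Fin n5) : Rel (g k (B i) * g k (E i') - g k (E i') * g k (B i)) (0)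
  | BF (i : Fin n2) (i' : Fin n6) : Rel (g k (B i) * g k (F i') - g k (F i') * g k (B i)) (0)
  | BG (i : Fin n2) (i' : Fin n7) : Rel (g k (B i) * g k (G i') - g k (G i') * g k (B i)) (0)
  | BH (i : Fin n2) (i' : Fin n8) : Rel (g k (B i) * g k (H i') - g k (H i') * g k (B i)) (0)
  | CE (i : Fin n3) (i' : Fin n5) : Rel (g k (C i) * g k (E i') - g k (E i') * g k (C i)) (0)
  | CF (i : Fin n3) (i' : Fin n6) : Rel (g k (C i) * g k (F i') - g k (F i') * g k (C i)) (0)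
  | CG (i : Fin n3) (i' : Fin n7) : Rel (g k (C i) * g k (G i') - g k (G i') * g k (C i)) (0)
  | CH (i : Fin n3) (i' : Fin n8) : Rel (g k (C i) * g k (H i') - g k (H i') * g k (C i)) (0)
  | DE (i : Fin n4) (i' : Fin n5) : Rel (g k (D i) * g k (E i') - g k (E i') * g k (D i)) (0)
  | DF (i : Fin n4) (i' : Fin n6) : Rel (g k (D i) * g k (F i') - g k (F i') * g k (D i)) (0)
  | DG (i : Fin n4) (i' : Fin n7) : Rel (g k (D i) * g k (G i') - g k (G i') * g k (D i)) (0)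
  | DH (i : Fin n4) (i' : Fin n8) : Rel (g k (D i) * g k (H i') - g k (H i') * g k (D i)) (0)

/-- The algebra `U_1(n1,…,n8; λ,μ,ν,γ)`. -/
abbrev U := RingQuot (Rel k xi n1 n2 n3 n4 n5 n6 n7 n8 lam mu nu gam)

/-- The quotient map. -/
noncomputable abbrev mk : FreeAlgebra k (Gen n1 n2 n3 n4 n5 n6 n7 n8) →ₐ[k] U k xi n1 n2 n3 n4 n5 n6 n7 n8 lam mu nu gam :=
  RingQuot.mkAlgHom k (Rel k xi n1 n2 n3 n4 n5 n6 n7 n8 lam mu nu gam)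

/-- The image of the monomial
`(∏ A_i^{α_i})(∏ B_j^{β_j})(∏ C_k^{γ_k})(∏ D_ℓ^{δ_ℓ})(∏ E_m^{ε_m})(∏ F_q^{φ_q})(∏ G_s^{σ_s})(∏ H_r^{ρ_r}) a^e b^f c^g d^h`,
with factors of each family taken in increasing index order. -/
noncomputable def mono
    (x : (Fin n1 → Fin 2) × (Fin n2 → Fin 2) × (Fin n3 → Fin 2) × (Fin n4 → Fin 2) ×
      (Fin n5 → Fin 2) × (Fin n6 → Fin 2) × (Fin n7 → Fin 2) × (Fin n8 → Fin 2) ×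
      Fin 2 × Fin 2 × Fin 2 × Fin 2) : U k xi n1 n2 n3 n4 n5 n6 n7 n8 lam mu nu gam :=
  match x with
  | ⟨eA, eB, eC, eD, eE, eF, eG, eH, ea, eb, ec, ed⟩ =>
    mk k xi n1 n2 n3 n4 n5 n6 n7 n8 lam mu nu gam
      ((List.ofFn fun i => g k (A i) ^ (eA i).val).prod *
        (List.ofFn fun j => g k (B j) ^ (eB j).val).prod *
        (List.ofFn fun i => g k (C i) ^ (eC i).val).prod *
        (List.ofFn fun l => g k (D l) ^ (eD l).val).prod *
        (List.ofFn fun m => g k (E m) ^ (eE m).val).prod *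
        (List.ofFn fun q => g k (F q) ^ (eF q).val).prod *
        (List.ofFn fun s => g k (G s) ^ (eG s).val).prod *
        (List.ofFn fun r => g k (H r) ^ (eH r).val).prod *
        g k a ^ ea.val * g k b ^ eb.val * g k c ^ ec.val * g k d ^ ed.val)

section Presentation

variable {k}

/-- Elements `ga, gb, gc, gd` and `x i` (for `i` in the list `l`) of an algebra satisfy the defining
relations of `U_1`, with the parameters recorded uniformly: `β` and `ζ` are the characters by which
`b, c` and `d` skew-commute with `x i`, and `Λ` is the symmetric matrix of linking parameters. -/
structure IsRep {X R : Type*} [Ring R] [Algebra k R] (β ζ : X → k) (Λ : X → X → k) (l : List X)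
    (ga gb gc gd : R) (x : X → R) : Prop where
  aa : ga * ga = 1
  bb : gb * gb = 1
  cc : gc * gc = 1
  ab : ga * gb = gb * ga
  ac : ga * gc = gc * ga
  bc : gb * gc = gc * gb
  dd : gd * gd = ga
  da : gd * ga = ga * gd
  db : gd * gb = gc * gd
  dc : gd * gc = gb * gd
  ax : ∀ i ∈ l, ga * x i = -(x i * ga)
  bx : ∀ i ∈ l, gb * x i = β i • (x i * gb)
  cx : ∀ i ∈ l, gc * x i = β i • (x i * gc)
  dx : ∀ i ∈ l, gd * x i = ζ i • (x i * gd)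
  xx : ∀ i ∈ l, ∀ j ∈ l, x i * x j + (β i * β j) • (x j * x i) = Λ i j • (1 - gb * gc)

/-- Compatibility conditions on the parameters of `IsRep`. -/
structure IsDatum {X : Type*} (β ζ : X → k) (Λ : X → X → k) : Prop where
  sq : ∀ i, β i * β i = 1
  symm : ∀ i j, Λ i j = Λ j i
  diag : ∀ i, Λ i i = 0
  eq_of_ne : ∀ i j, Λ i j ≠ 0 → β i = β j
  mul_of_ne : ∀ i j, Λ i j ≠ 0 → ζ i * ζ j = 1

namespace IsRep

section Span

variable {X R : Type*} [Ring R] [Algebra k R] {β ζ : X → k} {Λ : X → X → k} {l : List X}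
  {ga gb gc gd : R} {x : X → R}

lemma tail {i : X} (h : IsRep β ζ Λ (i :: l) ga gb gc gd x) : IsRep β ζ Λ l ga gb gc gd x where
  __ := h
  ax := fun j hj => h.ax j (List.mem_cons_of_mem _ hj)
  bx := fun j hj => h.bx j (List.mem_cons_of_mem _ hj)
  cx := fun j hj => h.cx j (List.mem_cons_of_mem _ hj)
  dx := fun j hj => h.dx j (List.mem_cons_of_mem _ hj)
  xx := fun j hj m hm => h.xx j (List.mem_cons_of_mem _ hj) m (List.mem_cons_of_mem _ hm)

lemma bc_mul (hD : IsDatum β ζ Λ) (h : IsRep β ζ Λ l ga gb gc gd x) {i : X} (hi : i ∈ l) :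
    gb * gc * x i = x i * (gb * gc) := by
  rw [mul_assoc, h.cx i hi, mul_smul_comm, ← mul_assoc, h.bx i hi, smul_mul_assoc, smul_smul,
    hD.sq, one_smul, mul_assoc]

lemma mul_self_eq_zero [CharZero k] (hD : IsDatum β ζ Λ) (h : IsRep β ζ Λ l ga gb gc gd x) {i : X}
    (hi : i ∈ l) : x i * x i = 0 := by
  have h2 := h.xx i hi i hi
  rw [hD.sq, hD.diag, one_smul, zero_smul, ← two_smul k] at h2
  exact (smul_eq_zero.mp h2).resolve_left two_ne_zero

/-- The ordered monomials in `ga, gb, gc, gd`. -/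
def coreMonomials (ga gb gc gd : R) : Set R :=
  Set.range fun e : Fin 2 × Fin 2 × Fin 2 × Fin 2 =>
    ga ^ e.1.val * gb ^ e.2.1.val * gc ^ e.2.2.1.val * gd ^ e.2.2.2.val

lemma mem_coreMonomials (ga gb gc gd : R) {e f m n : ℕ} (he : e < 2) (hf : f < 2) (hm : m < 2)
    (hn : n < 2) : ga ^ e * gb ^ f * gc ^ m * gd ^ n ∈ coreMonomials ga gb gc gd :=
  ⟨(⟨e, he⟩, ⟨f, hf⟩, ⟨m, hm⟩, ⟨n, hn⟩), rfl⟩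

lemma a_mul_mem_core (h : IsRep β ζ Λ l ga gb gc gd x) {t : R}
    (ht : t ∈ coreMonomials ga gb gc gd) : ga * t ∈ coreMonomials ga gb gc gd := by
  obtain ⟨⟨e, f, m, n⟩, rfl⟩ := ht
  fin_cases e
  · convert mem_coreMonomials ga gb gc gd one_lt_two f.2 m.2 n.2 using 1
    simp [mul_assoc]
  · convert mem_coreMonomials ga gb gc gd two_pos f.2 m.2 n.2 using 1
    simp [← mul_assoc, h.aa]

lemma b_mul_mem_core (h : IsRep β ζ Λ l ga gb gc gd x) {t : R}
    (ht : t ∈ coreMonomials ga gb gc gd) : gb * t ∈ coreMonomials ga gb gc gd := by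
  obtain ⟨⟨e, f, m, n⟩, rfl⟩ := ht
  have hc : Commute gb (ga ^ e.val) := Commute.pow_right h.ab.symm _
  fin_cases f
  · convert mem_coreMonomials ga gb gc gd e.2 one_lt_two m.2 n.2 using 1
    simp [← mul_assoc, hc.eq]
  · convert mem_coreMonomials ga gb gc gd e.2 two_pos m.2 n.2 using 1
    simp only [← mul_assoc, hc.eq]
    simp [mul_assoc (ga ^ e.val) gb gb, h.bb]

lemma c_mul_mem_core (h : IsRep β ζ Λ l ga gb gc gd x) {t : R}
    (ht : t ∈ coreMonomials ga gb gc gd) : gc * t ∈ coreMonomials ga gb gc gd := by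
  obtain ⟨⟨e, f, m, n⟩, rfl⟩ := ht
  have hc : Commute gc (ga ^ e.val * gb ^ f.val) :=
    (Commute.pow_right h.ac.symm _).mul_right (Commute.pow_right h.bc.symm _)
  fin_cases m
  · convert mem_coreMonomials ga gb gc gd e.2 f.2 one_lt_two n.2 using 1
    simp only [← mul_assoc]
    rw [mul_assoc gc, hc.eq]
    simp
  · convert mem_coreMonomials ga gb gc gd e.2 f.2 two_pos n.2 using 1
    simp only [← mul_assoc]
    rw [mul_assoc gc, hc.eq]
    simp [mul_assoc _ gc gc, h.cc]

lemma d_mul_mem_core (h : IsRep β ζ Λ l ga gb gc gd x) {t : R}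
    (ht : t ∈ coreMonomials ga gb gc gd) : gd * t ∈ coreMonomials ga gb gc gd := by
  obtain ⟨⟨e, f, m, n⟩, rfl⟩ := ht
  have hd : gd * (ga ^ e.val * gb ^ f.val * gc ^ m.val) =
      ga ^ e.val * gb ^ m.val * gc ^ f.val * gd := by
    have h1 : SemiconjBy gd (ga ^ e.val) (ga ^ e.val) := SemiconjBy.pow_right h.da _
    have h2 : SemiconjBy gd (gb ^ f.val) (gc ^ f.val) := SemiconjBy.pow_right h.db _
    have h3 : SemiconjBy gd (gc ^ m.val) (gb ^ m.val) := SemiconjBy.pow_right h.dc _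
    have h4 : Commute (gb ^ m.val) (gc ^ f.val) := Commute.pow_pow h.bc _ _
    rw [((h1.mul_right h2).mul_right h3).eq, mul_assoc (ga ^ e.val), ← h4.eq, ← mul_assoc]
  have hd' : gd * (ga ^ e.val * gb ^ f.val * gc ^ m.val * gd ^ n.val) =
      ga ^ e.val * gb ^ m.val * gc ^ f.val * gd ^ (n.val + 1) := by
    rw [← mul_assoc, hd, pow_succ', mul_assoc]
  rw [hd']
  fin_cases n
  · exact mem_coreMonomials ga gb gc gd e.2 m.2 f.2 one_lt_two
  · have ha : Commute ga (ga ^ e.val * gb ^ m.val * gc ^ f.val) :=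
      ((Commute.pow_right rfl _).mul_right (Commute.pow_right h.ab _)).mul_right
        (Commute.pow_right h.ac _)
    convert h.a_mul_mem_core (mem_coreMonomials ga gb gc gd e.2 m.2 f.2 two_pos) using 1
    simp [pow_succ, h.dd, ha.eq]

/-- The span of the ordered monomials, with the generators `x i` ordered as in the list. -/
def orderedSpan (ga gb gc gd : R) (x : X → R) : List X → Submodule k R
  | [] => Submodule.span k (coreMonomials ga gb gc gd)
  | i :: l => orderedSpan ga gb gc gd x l ⊔
      (orderedSpan ga gb gc gd x l).map (LinearMap.mulLeft k (x i))

lemma one_mem_orderedSpan (ga gb gc gd : R) (x : X → R) (l : List X) :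
    (1 : R) ∈ orderedSpan (k := k) ga gb gc gd x l := by
  induction l with
  | nil =>
    exact Submodule.subset_span (by
      simpa using mem_coreMonomials ga gb gc gd two_pos two_pos two_pos two_pos)
  | cons i l ih => exact Submodule.mem_sup_left ih

lemma mul_mem_orderedSpan_cons (ga gb gc gd : R) (x : X → R) (l : List X) (i : X) {t : R}
    (ht : t ∈ orderedSpan (k := k) ga gb gc gd x l) :
    x i * t ∈ orderedSpan (k := k) ga gb gc gd x (i :: l) :=
  Submodule.mem_sup_right ⟨t, ht, rfl⟩

/-- An element skew-commuting with every `x i` preserves the ordered span if it preserves the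
core. -/
lemma skew_mul_mem_orderedSpan (l : List X) {u : R} (χ : X → k)
    (hu : ∀ i ∈ l, u * x i = χ i • (x i * u))
    (hcore : ∀ t ∈ coreMonomials ga gb gc gd, u * t ∈ coreMonomials ga gb gc gd) {t : R}
    (ht : t ∈ orderedSpan (k := k) ga gb gc gd x l) :
    u * t ∈ orderedSpan (k := k) ga gb gc gd x l := by
  induction l generalizing t with
  | nil =>
    have : orderedSpan (k := k) ga gb gc gd x [] ≤
        (orderedSpan (k := k) ga gb gc gd x []).comap (LinearMap.mulLeft k u) :=
      Submodule.span_le.mpr fun s hs => Submodule.subset_span (hcore s hs)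
    exact this ht
  | cons i l ih =>
    have ih' := fun s => ih (t := s) fun j hj => hu j (List.mem_cons_of_mem _ hj)
    obtain ⟨p, hp, q, ⟨r, hr, rfl⟩, rfl⟩ := Submodule.mem_sup.mp ht
    rw [mul_add, LinearMap.mulLeft_apply, ← mul_assoc, hu i List.mem_cons_self, smul_mul_assoc,
      mul_assoc]
    exact add_mem (Submodule.mem_sup_left (ih' p hp))
      (Submodule.smul_mem _ _ (mul_mem_orderedSpan_cons _ _ _ _ _ _ _ (ih' r hr)))

lemma x_mul_mem_orderedSpan [CharZero k] (hD : IsDatum β ζ Λ)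
    (h : IsRep β ζ Λ l ga gb gc gd x) {i : X} (hi : i ∈ l) {t : R}
    (ht : t ∈ orderedSpan (k := k) ga gb gc gd x l) :
    x i * t ∈ orderedSpan (k := k) ga gb gc gd x l := by
  induction l generalizing t with
  | nil => simp at hi
  | cons j l ih =>
    obtain ⟨p, hp, q, ⟨r, hr, rfl⟩, rfl⟩ := Submodule.mem_sup.mp ht
    rw [mul_add, LinearMap.mulLeft_apply]
    by_cases hij : i = j
    · subst hij
      rw [← mul_assoc, h.mul_self_eq_zero hD hi, zero_mul, add_zero]
      exact mul_mem_orderedSpan_cons _ _ _ _ _ _ _ hp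
    · have hil : i ∈ l := by simpa [hij] using hi
      have hswap : x i * x j = Λ i j • (1 - gb * gc) - (β i * β j) • (x j * x i) :=
        eq_sub_of_add_eq (h.xx i hi j List.mem_cons_self)
      have hbc : gb * gc * r ∈ orderedSpan (k := k) ga gb gc gd x l :=
        skew_mul_mem_orderedSpan l (fun _ => 1)
          (fun m hm => by rw [one_smul, h.tail.bc_mul hD hm])
          (fun s hs => by
            rw [mul_assoc]; exact h.b_mul_mem_core (h.c_mul_mem_core hs)) hr
      refine add_mem (Submodule.mem_sup_left (ih h.tail hil hp)) ?_
      rw [← mul_assoc, hswap, sub_mul, smul_mul_assoc, smul_mul_assoc, sub_mul, one_mul,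
        mul_assoc (x j)]
      exact sub_mem (Submodule.mem_sup_left (Submodule.smul_mem _ _ (sub_mem hr hbc)))
        (Submodule.smul_mem _ _ (mul_mem_orderedSpan_cons _ _ _ _ _ _ _ (ih h.tail hil hr)))

open Pointwise in
lemma orderedSpan_le (ga gb gc gd : R) (x : X → R) (l : List X) :
    orderedSpan (k := k) ga gb gc gd x l ≤
      Submodule.span k ((l.map fun i => ({1, x i} : Set R)).prod * coreMonomials ga gb gc gd) := by
  induction l with
  | nil => simp [orderedSpan]
  | cons i l ih =>
    rw [List.map_cons, List.prod_cons, mul_assoc]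
    refine sup_le (ih.trans (Submodule.span_mono fun s hs => ?_)) ?_
    · exact ⟨1, by simp, s, hs, one_mul s⟩
    · refine (Submodule.map_mono ih).trans ?_
      rw [Submodule.map_span]
      refine Submodule.span_mono ?_
      rintro _ ⟨s, hs, rfl⟩
      exact ⟨x i, by simp, s, hs, rfl⟩

end Span

section Model

variable {W : Type*} [AddCommGroup W] [Module k W]

/-- The endomorphism of `W × W` given by a `2 × 2` block matrix of endomorphisms of `W`. -/
def block (f g p q : Module.End k W) : Module.End k (W × W) :=
  (f.coprod g).prod (p.coprod q)

@[simp] lemma block_apply (f g p q : Module.End k W) (w : W × W) :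
    block f g p q w = (f w.1 + g w.2, p w.1 + q w.2) := rfl

lemma block_mul (f g p q f' g' p' q' : Module.End k W) :
    block f g p q * block f' g' p' q' =
      block (f * f' + g * p') (f * g' + g * q') (p * f' + q * p') (p * g' + q * q') := by
  refine LinearMap.ext fun w => Prod.ext ?_ ?_ <;> simp <;> abel

lemma block_add (f g p q f' g' p' q' : Module.End k W) :
    block f g p q + block f' g' p' q' = block (f + f') (g + g') (p + p') (q + q') := by
  refine LinearMap.ext fun w => Prod.ext ?_ ?_ <;> simp <;> abel

lemma block_sub (f g p q f' g' p' q' : Module.End k W) :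
    block f g p q - block f' g' p' q' = block (f - f') (g - g') (p - p') (q - q') := by
  refine LinearMap.ext fun w => Prod.ext ?_ ?_ <;> simp <;> abel

lemma block_neg (f g p q : Module.End k W) :
    -block f g p q = block (-f) (-g) (-p) (-q) := by
  refine LinearMap.ext fun w => Prod.ext ?_ ?_ <;> simp <;> abel

lemma block_smul (r : k) (f g p q : Module.End k W) :
    r • block f g p q = block (r • f) (r • g) (r • p) (r • q) := by
  refine LinearMap.ext fun w => Prod.ext ?_ ?_ <;> simp

lemma block_zero : block (0 : Module.End k W) 0 0 0 = 0 := by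
  refine LinearMap.ext fun w => Prod.ext ?_ ?_ <;> simp

lemma one_eq_block : (1 : Module.End k (W × W)) = block 1 0 0 1 := by
  refine LinearMap.ext fun w => Prod.ext ?_ ?_ <;> simp

variable {X : Type*} {β ζ : X → k} {Λ : X → X → k} {l : List X} {ga gb gc gd : Module.End k W}
  {x : X → Module.End k W}

/-- The action of the generators on `W × W`, thought of as `W ⊕ x_i W`. -/
def extend [DecidableEq X] (β : X → k) (Λ : X → X → k) (gb gc : Module.End k W)
    (x : X → Module.End k W) (i j : X) : Module.End k (W × W) :=
  if j = i then block 0 0 1 0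
  else block (x j) (Λ j i • (1 - gb * gc)) 0 (-((β j * β i) • x j))

lemma extend_isRep [DecidableEq X] (hD : IsDatum β ζ Λ) (h : IsRep β ζ Λ l ga gb gc gd x) {i : X}
    (hi : i ∉ l) (hζ : ζ i * ζ i = -1) :
    IsRep β ζ Λ (i :: l) (block ga 0 0 (-ga)) (block gb 0 0 (β i • gb)) (block gc 0 0 (β i • gc))
      (block gd 0 0 (ζ i • gd)) (extend β Λ gb gc x i) := by
  have hself : extend β Λ gb gc x i i = block 0 0 1 0 := if_pos rfl
  have hmem : ∀ j ∈ l, extend β Λ gb gc x i j =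
      block (x j) (Λ j i • (1 - gb * gc)) 0 (-((β j * β i) • x j)) :=
    fun j hj => if_neg (ne_of_mem_of_not_mem hj hi)
  have hΛβ : ∀ m j, Λ m j * (β m * β j) = Λ m j := fun m j => by
    by_cases h0 : Λ m j = 0
    · rw [h0, zero_mul]
    · rw [hD.eq_of_ne m j h0, hD.sq, mul_one]
  have hΛζ : ∀ m j, Λ m j * (ζ m * ζ j) = Λ m j := fun m j => by
    by_cases h0 : Λ m j = 0
    · rw [h0, zero_mul]
    · rw [hD.mul_of_ne m j h0, mul_one]
  have hz : 1 - block gb 0 0 (β i • gb) * block gc 0 0 (β i • gc) =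
      block (1 - gb * gc) 0 0 (1 - gb * gc) := by
    simp [block_mul, one_eq_block, block_sub, smul_smul, hD.sq]
  set z := 1 - gb * gc with hzdef
  have hza : ga * z = z * ga := by
    rw [hzdef, mul_sub, sub_mul, ← mul_assoc, h.ab, mul_assoc, h.ac, mul_one, one_mul, mul_assoc]
  have hzb : gb * z = z * gb := by
    rw [hzdef, mul_sub, sub_mul, mul_assoc gb gc, ← h.bc, mul_one, one_mul]
  have hzc : gc * z = z * gc := by
    rw [hzdef, mul_sub, sub_mul, ← mul_assoc, ← h.bc, mul_one, one_mul]
  have hzd : gd * z = z * gd := by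
    rw [hzdef, mul_sub, sub_mul, ← mul_assoc, h.db, mul_assoc, h.dc, ← mul_assoc, ← h.bc,
      mul_one, one_mul]
  have hzx : ∀ j ∈ l, x j * z = z * x j := fun j hj => by
    rw [hzdef, mul_sub, sub_mul, h.bc_mul hD hj, mul_one, one_mul]
  have hxx : ∀ j ∈ l, ∀ m ∈ l, x j * x m = Λ j m • z - (β j * β m) • (x m * x j) :=
    fun j hj m hm => eq_sub_of_add_eq (h.xx j hj m hm)
  refine ⟨?_, ?_, ?_, ?_, ?_, ?_, ?_, ?_, ?_, ?_, ?_, ?_, ?_, ?_, ?_⟩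
  · simp [block_mul, one_eq_block, h.aa]
  · simp [block_mul, one_eq_block, h.bb, smul_smul, hD.sq]
  · simp [block_mul, one_eq_block, h.cc, smul_smul, hD.sq]
  · simp [block_mul, h.ab]
  · simp [block_mul, h.ac]
  · simp [block_mul, h.bc]
  · simp [block_mul, h.dd, smul_smul, hζ]
  · simp [block_mul, h.da]
  · simp [block_mul, h.db, smul_smul, mul_comm]
  · simp [block_mul, h.dc, smul_smul, mul_comm]
  · rintro j (_ | ⟨_, hj⟩)
    · simp [hself, block_mul, block_neg]
    · simp [hmem j hj, block_mul, block_neg, h.ax j hj, hza]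
  · rintro j (_ | ⟨_, hj⟩)
    · simp [hself, block_mul, block_smul]
    · have := hΛβ j i
      simp only [hmem j hj, block_mul, block_smul]
      congr 1 <;> simp [h.bx j hj, hzb, smul_smul]
      · congr 1; linear_combination -this
      · congr 1; ring
  · rintro j (_ | ⟨_, hj⟩)
    · simp [hself, block_mul, block_smul]
    · have := hΛβ j i
      simp only [hmem j hj, block_mul, block_smul]
      congr 1 <;> simp [h.cx j hj, hzc, smul_smul]
      · congr 1; linear_combination -this
      · congr 1; ring
  · rintro j (_ | ⟨_, hj⟩)
    · simp [hself, block_mul, block_smul]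
    · have := hΛζ j i
      simp only [hmem j hj, block_mul, block_smul]
      congr 1 <;> simp [h.dx j hj, hzd, smul_smul]
      · congr 1; linear_combination -this
      · congr 1; ring
  · rw [hz]
    rintro j (_ | ⟨_, hj⟩) m (_ | ⟨_, hm⟩)
    · simp [hself, block_mul, hD.diag, block_zero]
    · have := hΛβ m i
      simp only [hself, hmem m hm, block_mul, block_smul, block_add]
      congr 1 <;> simp [smul_smul, hD.symm i m, mul_comm (β i)]
      · rw [mul_comm, this]
      · rw [mul_mul_mul_comm, hD.sq, hD.sq, one_mul, one_smul, add_neg_cancel]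
    · have := hΛβ j i
      simp only [hself, hmem j hj, block_mul, block_smul, block_add]
      congr 1 <;> simp [smul_smul]
      rw [mul_comm, this]
    · simp only [hmem j hj, hmem m hm, block_mul, block_smul, block_add]
      congr 1
      · simp [hxx j hj m hm]
      · have h1 : Λ m i * (1 - β j * β m * (β j * β i)) = 0 := by
          linear_combination -hΛβ m i - Λ m i * β m * β i * hD.sq j
        have h2 : Λ j i * (β j * β m - β m * β i) = 0 := by
          by_cases h0 : Λ j i = 0
          · rw [h0, zero_mul]
          · rw [hD.eq_of_ne j i h0]; ring
        simp only [mul_smul_comm, smul_mul_assoc, mul_neg, hzx j hj, hzx m hm]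
        linear_combination (norm := module) h1 • (z * x j) + h2 • (z * x m)
      · simp
      · have h1 : β j * β m * Λ j m = Λ j m := by rw [mul_comm, hΛβ]
        have h2 : β j * β i * (β m * β i) = β j * β m := by
          rw [mul_mul_mul_comm, hD.sq, mul_one]
        have h3 := h2
        rw [mul_comm] at h3
        rw [zero_mul, zero_mul, zero_add, zero_add, neg_mul_neg, neg_mul_neg, smul_mul_smul_comm,
          smul_mul_smul_comm, h2, h3, hxx j hj m hm, smul_sub, smul_smul, h1, sub_add_cancel]

/-- A vector is cyclic when no proper subspace contains it and is stable under all generators. -/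
def IsCyclic (l : List X) (ga gb gc gd : Module.End k W) (x : X → Module.End k W) (v : W) : Prop :=
  ∀ S : Submodule k W, v ∈ S → (∀ w ∈ S, ga w ∈ S) → (∀ w ∈ S, gb w ∈ S) → (∀ w ∈ S, gc w ∈ S) →
    (∀ w ∈ S, gd w ∈ S) → (∀ i ∈ l, ∀ w ∈ S, x i w ∈ S) → S = ⊤

/-- The endomorphism of the group algebra of `⟨b, c⟩ ⋊ ⟨d⟩` permuting its basis by `f`. -/
noncomputable def translation (f : ZMod 2 × ZMod 2 × ZMod 4 → ZMod 2 × ZMod 2 × ZMod 4) :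
    Module.End k ((ZMod 2 × ZMod 2 × ZMod 4) →₀ k) :=
  Finsupp.lmapDomain k k f

lemma translation_mul (f f' : ZMod 2 × ZMod 2 × ZMod 4 → ZMod 2 × ZMod 2 × ZMod 4) :
    translation (k := k) f * translation f' = translation (f ∘ f') :=
  (Finsupp.lmapDomain_comp k k f' f).symm

lemma translation_eq_one {f : ZMod 2 × ZMod 2 × ZMod 4 → ZMod 2 × ZMod 2 × ZMod 4}
    (hf : ∀ w, f w = w) : translation (k := k) f = 1 := by
  rw [funext hf]
  exact Finsupp.lmapDomain_id k k

lemma translation_single (f : ZMod 2 × ZMod 2 × ZMod 4 → ZMod 2 × ZMod 2 × ZMod 4)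
    (w : ZMod 2 × ZMod 2 × ZMod 4) (r : k) :
    translation f (Finsupp.single w r) = Finsupp.single (f w) r :=
  Finsupp.mapDomain_single

lemma core_isRep (x : X → Module.End k ((ZMod 2 × ZMod 2 × ZMod 4) →₀ k)) :
    IsRep β ζ Λ []
      (translation fun w => (w.1, w.2.1, w.2.2 + 2))
      (translation fun w => (w.1 + 1, w.2.1, w.2.2))
      (translation fun w => (w.1, w.2.1 + 1, w.2.2))
      (translation fun w => (w.2.1, w.1, w.2.2 + 1)) x where
  aa := by rw [translation_mul, translation_eq_one (by decide)]
  bb := by rw [translation_mul, translation_eq_one (by decide)]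
  cc := by rw [translation_mul, translation_eq_one (by decide)]
  ab := by simp only [translation_mul]; rfl
  ac := by simp only [translation_mul]; rfl
  bc := by simp only [translation_mul]; rfl
  dd := by rw [translation_mul]; congr 1; decide
  da := by simp only [translation_mul]; congr 1; decide
  db := by simp only [translation_mul]; rfl
  dc := by simp only [translation_mul]; rfl
  ax := by simp
  bx := by simp
  cx := by simp
  dx := by simp
  xx := by simp

lemma core_isCyclic (x : X → Module.End k ((ZMod 2 × ZMod 2 × ZMod 4) →₀ k)) :
    IsCyclic []
      (translation fun w => (w.1, w.2.1, w.2.2 + 2))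
      (translation fun w => (w.1 + 1, w.2.1, w.2.2))
      (translation fun w => (w.1, w.2.1 + 1, w.2.2))
      (translation fun w => (w.2.1, w.1, w.2.2 + 1)) x (Finsupp.single 0 1) := by
  intro S h0 ha hb hc hd _
  have hb' : ∀ p q r, Finsupp.single (p, q, r) 1 ∈ S → Finsupp.single (p + 1, q, r) 1 ∈ S :=
    fun p q r h => by simpa only [translation_single] using hb _ h
  have hc' : ∀ p q r, Finsupp.single (p, q, r) 1 ∈ S → Finsupp.single (p, q + 1, r) 1 ∈ S :=
    fun p q r h => by simpa only [translation_single] using hc _ h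
  have hd' : ∀ p q r, Finsupp.single (p, q, r) 1 ∈ S → Finsupp.single (q, p, r + 1) 1 ∈ S :=
    fun p q r h => by simpa only [translation_single] using hd _ h
  have key : ∀ n m r : ℕ, Finsupp.single ((n, m, r) : ZMod 2 × ZMod 2 × ZMod 4) (1 : k) ∈ S := by
    intro n m r
    induction n with
    | zero =>
      induction m with
      | zero =>
        induction r with
        | zero => exact_mod_cast h0
        | succ r ih => simpa using hd' _ _ _ ih
      | succ m ih => simpa using hc' _ _ _ ih
    | succ n ih => simpa using hb' _ _ _ ih
  have hs : ∀ w, Finsupp.single w (1 : k) ∈ S := fun w => by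
    simpa using key w.1.val w.2.1.val w.2.2.val
  refine eq_top_iff.mpr fun f _ => ?_
  induction f using Finsupp.induction_linear with
  | zero => exact S.zero_mem
  | add f f' hf hf' => exact S.add_mem (hf trivial) (hf' trivial)
  | single w r => simpa using S.smul_mem r (hs w)

lemma extend_isCyclic [DecidableEq X] {v : W} (h : IsCyclic l ga gb gc gd x v) {i : X}
    (hi : i ∉ l) (r : k) :
    IsCyclic (i :: l) (block ga 0 0 (-ga)) (block gb 0 0 (β i • gb)) (block gc 0 0 (β i • gc))
      (block gd 0 0 (r • gd)) (extend β Λ gb gc x i) (v, 0) := by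
  intro S h0 ha hb hc hd hx
  have hinl : ∀ w : W, (w, (0 : W)) ∈ S := by
    have htop : S.comap (LinearMap.inl k W W) = ⊤ := by
      refine h _ h0 (fun w hw => ?_) (fun w hw => ?_) (fun w hw => ?_) (fun w hw => ?_)
        (fun j hj w hw => ?_)
      · simpa using ha _ hw
      · simpa using hb _ hw
      · simpa using hc _ hw
      · simpa using hd _ hw
      · have hji : j ≠ i := ne_of_mem_of_not_mem hj hi
        simpa [extend, hji] using hx j (List.mem_cons_of_mem _ hj) _ hw
    exact fun w => (Submodule.eq_top_iff'.mp htop w :)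
  have hinr : ∀ w : W, ((0 : W), w) ∈ S := fun w => by
    simpa [extend] using hx i List.mem_cons_self _ (hinl w)
  refine Submodule.eq_top_iff'.mpr fun w => ?_
  simpa using S.add_mem (hinl w.1) (hinr w.2)

end Model

section Existence

universe u

variable {K : Type u} [Field K] {X : Type*} {β ζ : X → K} {Λ : X → X → K}

/-- There is a cyclic module of dimension `2 ^ (4 + l.length)`. -/
lemma exists_isCyclic (hD : IsDatum β ζ Λ) (hζ : ∀ i, ζ i * ζ i = -1) {l : List X} (hl : l.Nodup) :
    ∃ (W : Type u) (_ : AddCommGroup W) (_ : Module K W) (ga gb gc gd : Module.End K W)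
      (x : X → Module.End K W) (v : W), IsRep β ζ Λ l ga gb gc gd x ∧
        IsCyclic l ga gb gc gd x v ∧ FiniteDimensional K W ∧
        Module.finrank K W = 2 ^ (4 + l.length) := by
  classical
  induction l with
  | nil =>
    exact ⟨_, _, _, _, _, _, _, 0, _, core_isRep 0, core_isCyclic 0, inferInstance, by
      rw [Module.finrank_finsupp_self]; rfl⟩
  | cons i l ih =>
    obtain ⟨hi, hl⟩ := List.nodup_cons.mp hl
    obtain ⟨W, _, _, ga, gb, gc, gd, x, v, hrep, hcyc, _, hdim⟩ := ih hl
    exact ⟨W × W, _, _, _, _, _, _, _, _, extend_isRep hD hrep hi (hζ i),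
      extend_isCyclic hcyc hi (ζ i), inferInstance, by
        rw [Module.finrank_prod, hdim, List.length_cons]; ring⟩

end Existence

end IsRep

section Parameters

variable {n1 n2 n3 n4 n5 n6 n7 n8}

/-- The sign by which `b` and `c` skew-commute with a generator. -/
def betaChar : Gen n1 n2 n3 n4 n5 n6 n7 n8 → k
  | E _ | F _ | G _ | H _ => -1
  | _ => 1

/-- The scalar by which `d` skew-commutes with a generator. -/
def zetaChar (xi : k) : Gen n1 n2 n3 n4 n5 n6 n7 n8 → k
  | A _ | C _ | E _ | G _ => -xi
  | _ => xi

/-- The symmetric matrix of all linking parameters. -/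
def link (lam : Matrix (Fin n1) (Fin n4) k) (mu : Matrix (Fin n2) (Fin n3) k)
    (nu : Matrix (Fin n5) (Fin n8) k) (gam : Matrix (Fin n6) (Fin n7) k) :
    Gen n1 n2 n3 n4 n5 n6 n7 n8 → Gen n1 n2 n3 n4 n5 n6 n7 n8 → k
  | A i, D j => lam i j
  | D j, A i => lam i j
  | B i, C j => mu i j
  | C j, B i => mu i j
  | E i, H j => nu i j
  | H j, E i => nu i j
  | F i, G j => gam i j
  | G j, F i => gam i j
  | _, _ => 0

/-- The skew generators in their standard order. -/
def skewGens (n1 n2 n3 n4 n5 n6 n7 n8 : ℕ) : List (Gen n1 n2 n3 n4 n5 n6 n7 n8) :=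
  List.ofFn A ++ List.ofFn B ++ List.ofFn C ++ List.ofFn D ++ List.ofFn E ++ List.ofFn F ++
    List.ofFn G ++ List.ofFn H

lemma nodup_skewGens : (skewGens n1 n2 n3 n4 n5 n6 n7 n8).Nodup := by
  simp [skewGens, List.nodup_append, List.nodup_ofFn, Function.Injective]
  aesop

lemma forall_mem_skewGens {p : Gen n1 n2 n3 n4 n5 n6 n7 n8 → Prop} :
    (∀ i ∈ skewGens n1 n2 n3 n4 n5 n6 n7 n8, p i) ↔
      (∀ i, p (A i)) ∧ (∀ i, p (B i)) ∧ (∀ i, p (C i)) ∧ (∀ i, p (D i)) ∧ (∀ i, p (E i)) ∧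
        (∀ i, p (F i)) ∧ (∀ i, p (G i)) ∧ ∀ i, p (H i) := by
  simp [skewGens, or_imp, forall_and]

lemma length_skewGens :
    (skewGens n1 n2 n3 n4 n5 n6 n7 n8).length = n1 + n2 + n3 + n4 + n5 + n6 + n7 + n8 := by
  simp [skewGens, add_assoc]

lemma isDatum (xi : k) (hxi : xi * xi = -1) (lam : Matrix (Fin n1) (Fin n4) k)
    (mu : Matrix (Fin n2) (Fin n3) k) (nu : Matrix (Fin n5) (Fin n8) k)
    (gam : Matrix (Fin n6) (Fin n7) k) :
    IsDatum betaChar (zetaChar xi) (link lam mu nu gam) where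
  sq i := by cases i <;> simp [betaChar]
  symm i j := by cases i <;> cases j <;> rfl
  diag i := by cases i <;> rfl
  eq_of_ne i j := by cases i <;> cases j <;> simp [link, betaChar]
  mul_of_ne i j := by cases i <;> cases j <;> simp [link, zetaChar, hxi]

variable {R : Type*} [Ring R] [Algebra k R]
  {f : FreeAlgebra k (Gen n1 n2 n3 n4 n5 n6 n7 n8) →ₐ[k] R}
  {xi : k} {lam : Matrix (Fin n1) (Fin n4) k} {mu : Matrix (Fin n2) (Fin n3) k}
  {nu : Matrix (Fin n5) (Fin n8) k} {gam : Matrix (Fin n6) (Fin n7) k}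

lemma linking_of_rel (hxi : xi * xi = -1)
    (hf : ∀ p q, Rel k xi n1 n2 n3 n4 n5 n6 n7 n8 lam mu nu gam p q → f p = f q) :
    ∀ i ∈ skewGens n1 n2 n3 n4 n5 n6 n7 n8, ∀ j ∈ skewGens n1 n2 n3 n4 n5 n6 n7 n8,
      f (g k i) * f (g k j) + (betaChar i * betaChar j : k) • (f (g k j) * f (g k i)) =
        link lam mu nu gam i j • (1 - f (g k b) * f (g k c)) := by
  have hD := isDatum xi hxi lam mu nu gam
  let P (i j : Gen n1 n2 n3 n4 n5 n6 n7 n8) : Prop :=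
    f (g k i) * f (g k j) + (betaChar i * betaChar j : k) • (f (g k j) * f (g k i)) =
      link lam mu nu gam i j • (1 - f (g k b) * f (g k c))
  have hadd : ∀ {i j r}, betaChar i = (betaChar j : k) → link lam mu nu gam i j = r →
      Rel k xi n1 n2 n3 n4 n5 n6 n7 n8 lam mu nu gam
        (g k i * g k j + g k j * g k i) (r • (1 - g k b * g k c)) → P i j := by
    intro i j r h1 h2 h
    simpa only [P, h1, h2, hD.sq, one_smul, map_add, map_mul, map_smul, map_sub,
      map_one] using hf _ _ h
  have hzero : ∀ {i j}, betaChar i = (betaChar j : k) → link lam mu nu gam i j = 0 →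
      Rel k xi n1 n2 n3 n4 n5 n6 n7 n8 lam mu nu gam (g k i * g k j + g k j * g k i) 0 →
      P i j := by
    intro i j h1 h2 h
    simpa only [P, h1, h2, hD.sq, one_smul, zero_smul, map_add, map_mul, map_zero] using hf _ _ h
  have hsub : ∀ {i j}, betaChar i = (1 : k) → betaChar j = (-1 : k) → link lam mu nu gam i j = 0 →
      Rel k xi n1 n2 n3 n4 n5 n6 n7 n8 lam mu nu gam (g k i * g k j - g k j * g k i) 0 →
      P i j := by
    intro i j h0 h1 h2 h
    simpa only [P, h0, h1, h2, one_mul, neg_smul, one_smul, zero_smul, ← sub_eq_add_neg,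
      map_sub, map_mul, map_zero] using hf _ _ h
  have hsymm : ∀ {i j}, P j i → P i j := by
    intro i j h
    have h1 : betaChar i * betaChar j * (betaChar j * betaChar i) = (1 : k) := by
      rw [mul_comm (betaChar j) (betaChar i), mul_mul_mul_comm, hD.sq, hD.sq, one_mul]
    have h2 : betaChar i * betaChar j * link lam mu nu gam j i = link lam mu nu gam i j := by
      rw [hD.symm j i]
      by_cases h0 : link lam mu nu gam i j = 0
      · rw [h0, mul_zero]
      · rw [hD.eq_of_ne i j h0, hD.sq, one_mul]
    have h3 := congrArg (fun t => (betaChar i * betaChar j : k) • t) h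
    simp only [smul_add, smul_smul, h1, h2, one_smul] at h3
    simp only [P]
    rw [← h3, add_comm]
  change ∀ i ∈ _, ∀ j ∈ _, P i j
  simp only [forall_mem_skewGens]
  refine ⟨fun i => ?_, fun i => ?_, fun i => ?_, fun i => ?_, fun i => ?_, fun i => ?_, fun i => ?_,
    fun i => ?_⟩
  · exact ⟨fun j => hzero rfl rfl (Rel.AA i j),
      fun j => hzero rfl rfl (Rel.AB i j),
      fun j => hzero rfl rfl (Rel.AC i j),
      fun j => hadd rfl rfl (Rel.AD i j),
      fun j => hsub rfl rfl rfl (Rel.AE i j),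
      fun j => hsub rfl rfl rfl (Rel.AF i j),
      fun j => hsub rfl rfl rfl (Rel.AG i j),
      fun j => hsub rfl rfl rfl (Rel.AH i j)⟩
  · exact ⟨fun j => hsymm (hzero rfl rfl (Rel.AB j i)),
      fun j => hzero rfl rfl (Rel.BB i j),
      fun j => hadd rfl rfl (Rel.BC i j),
      fun j => hzero rfl rfl (Rel.BD i j),
      fun j => hsub rfl rfl rfl (Rel.BE i j),
      fun j => hsub rfl rfl rfl (Rel.BF i j),
      fun j => hsub rfl rfl rfl (Rel.BG i j),
      fun j => hsub rfl rfl rfl (Rel.BH i j)⟩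
  · exact ⟨fun j => hsymm (hzero rfl rfl (Rel.AC j i)),
      fun j => hsymm (hadd rfl rfl (Rel.BC j i)),
      fun j => hzero rfl rfl (Rel.CC i j),
      fun j => hzero rfl rfl (Rel.CD i j),
      fun j => hsub rfl rfl rfl (Rel.CE i j),
      fun j => hsub rfl rfl rfl (Rel.CF i j),
      fun j => hsub rfl rfl rfl (Rel.CG i j),
      fun j => hsub rfl rfl rfl (Rel.CH i j)⟩
  · exact ⟨fun j => hsymm (hadd rfl rfl (Rel.AD j i)),
      fun j => hsymm (hzero rfl rfl (Rel.BD j i)),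
      fun j => hsymm (hzero rfl rfl (Rel.CD j i)),
      fun j => hzero rfl rfl (Rel.DD i j),
      fun j => hsub rfl rfl rfl (Rel.DE i j),
      fun j => hsub rfl rfl rfl (Rel.DF i j),
      fun j => hsub rfl rfl rfl (Rel.DG i j),
      fun j => hsub rfl rfl rfl (Rel.DH i j)⟩
  · exact ⟨fun j => hsymm (hsub rfl rfl rfl (Rel.AE j i)),
      fun j => hsymm (hsub rfl rfl rfl (Rel.BE j i)),
      fun j => hsymm (hsub rfl rfl rfl (Rel.CE j i)),
      fun j => hsymm (hsub rfl rfl rfl (Rel.DE j i)),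
      fun j => hzero rfl rfl (Rel.EE i j),
      fun j => hzero rfl rfl (Rel.EF i j),
      fun j => hzero rfl rfl (Rel.EG i j),
      fun j => hadd rfl rfl (Rel.EH i j)⟩
  · exact ⟨fun j => hsymm (hsub rfl rfl rfl (Rel.AF j i)),
      fun j => hsymm (hsub rfl rfl rfl (Rel.BF j i)),
      fun j => hsymm (hsub rfl rfl rfl (Rel.CF j i)),
      fun j => hsymm (hsub rfl rfl rfl (Rel.DF j i)),
      fun j => hsymm (hzero rfl rfl (Rel.EF j i)),
      fun j => hzero rfl rfl (Rel.FF i j),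
      fun j => hadd rfl rfl (Rel.FG i j),
      fun j => hzero rfl rfl (Rel.FH i j)⟩
  · exact ⟨fun j => hsymm (hsub rfl rfl rfl (Rel.AG j i)),
      fun j => hsymm (hsub rfl rfl rfl (Rel.BG j i)),
      fun j => hsymm (hsub rfl rfl rfl (Rel.CG j i)),
      fun j => hsymm (hsub rfl rfl rfl (Rel.DG j i)),
      fun j => hsymm (hzero rfl rfl (Rel.EG j i)),
      fun j => hsymm (hadd rfl rfl (Rel.FG j i)),
      fun j => hzero rfl rfl (Rel.GG i j),
      fun j => hzero rfl rfl (Rel.GH i j)⟩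
  · exact ⟨fun j => hsymm (hsub rfl rfl rfl (Rel.AH j i)),
      fun j => hsymm (hsub rfl rfl rfl (Rel.BH j i)),
      fun j => hsymm (hsub rfl rfl rfl (Rel.CH j i)),
      fun j => hsymm (hsub rfl rfl rfl (Rel.DH j i)),
      fun j => hsymm (hadd rfl rfl (Rel.EH j i)),
      fun j => hsymm (hzero rfl rfl (Rel.FH j i)),
      fun j => hsymm (hzero rfl rfl (Rel.GH j i)),
      fun j => hzero rfl rfl (Rel.HH i j)⟩

/-- An algebra map respecting the relations of `U_1` yields a system of elements satisfying the
uniform form of those relations. -/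
lemma isRep_of_rel (hxi : xi * xi = -1)
    (hf : ∀ p q, Rel k xi n1 n2 n3 n4 n5 n6 n7 n8 lam mu nu gam p q → f p = f q) :
    IsRep betaChar (zetaChar xi) (link lam mu nu gam) (skewGens n1 n2 n3 n4 n5 n6 n7 n8)
      (f (g k a)) (f (g k b)) (f (g k c)) (f (g k d)) (fun i => f (g k i)) where
  aa := by simpa using hf _ _ Rel.haa
  bb := by simpa using hf _ _ Rel.hbb
  cc := by simpa using hf _ _ Rel.hcc
  ab := by simpa using hf _ _ Rel.hab
  ac := by simpa using hf _ _ Rel.hac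
  bc := by simpa using hf _ _ Rel.hbc
  dd := by simpa using hf _ _ Rel.hdd
  da := by simpa using hf _ _ Rel.hda
  db := by simpa using hf _ _ Rel.hdb
  dc := by simpa using hf _ _ Rel.hdc
  ax := forall_mem_skewGens.mpr ⟨fun i => by simpa using hf _ _ (Rel.aA i),
    fun i => by simpa using hf _ _ (Rel.aB i),
    fun i => by simpa using hf _ _ (Rel.aC i),
    fun i => by simpa using hf _ _ (Rel.aD i),
    fun i => by simpa using hf _ _ (Rel.aE i),
    fun i => by simpa using hf _ _ (Rel.aF i),
    fun i => by simpa using hf _ _ (Rel.aG i),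
    fun i => by simpa using hf _ _ (Rel.aH i)⟩
  bx := forall_mem_skewGens.mpr ⟨fun i => by simpa [betaChar] using hf _ _ (Rel.bA i),
    fun i => by simpa [betaChar] using hf _ _ (Rel.bB i),
    fun i => by simpa [betaChar] using hf _ _ (Rel.bC i),
    fun i => by simpa [betaChar] using hf _ _ (Rel.bD i),
    fun i => by simpa [betaChar] using hf _ _ (Rel.bE i),
    fun i => by simpa [betaChar] using hf _ _ (Rel.bF i),
    fun i => by simpa [betaChar] using hf _ _ (Rel.bG i),
    fun i => by simpa [betaChar] using hf _ _ (Rel.bH i)⟩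
  cx := forall_mem_skewGens.mpr ⟨fun i => by simpa [betaChar] using hf _ _ (Rel.cA i),
    fun i => by simpa [betaChar] using hf _ _ (Rel.cB i),
    fun i => by simpa [betaChar] using hf _ _ (Rel.cC i),
    fun i => by simpa [betaChar] using hf _ _ (Rel.cD i),
    fun i => by simpa [betaChar] using hf _ _ (Rel.cE i),
    fun i => by simpa [betaChar] using hf _ _ (Rel.cF i),
    fun i => by simpa [betaChar] using hf _ _ (Rel.cG i),
    fun i => by simpa [betaChar] using hf _ _ (Rel.cH i)⟩
  dx := forall_mem_skewGens.mpr ⟨fun i => by simpa [zetaChar] using hf _ _ (Rel.dA i),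
    fun i => by simpa [zetaChar] using hf _ _ (Rel.dB i),
    fun i => by simpa [zetaChar] using hf _ _ (Rel.dC i),
    fun i => by simpa [zetaChar] using hf _ _ (Rel.dD i),
    fun i => by simpa [zetaChar] using hf _ _ (Rel.dE i),
    fun i => by simpa [zetaChar] using hf _ _ (Rel.dF i),
    fun i => by simpa [zetaChar] using hf _ _ (Rel.dG i),
    fun i => by simpa [zetaChar] using hf _ _ (Rel.dH i)⟩
  xx := linking_of_rel hxi hf

/-- The images of the generators prescribed by a system `ga, gb, gc, gd, x`. -/
def genImage (ga gb gc gd : R) (x : Gen n1 n2 n3 n4 n5 n6 n7 n8 → R) :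
    Gen n1 n2 n3 n4 n5 n6 n7 n8 → R
  | a => ga
  | b => gb
  | c => gc
  | d => gd
  | y => x y

/-- A system of elements satisfying the uniform form of the relations of `U_1` respects them. -/
lemma IsRep.lift_eq_of_rel {ga gb gc gd : R} {x : Gen n1 n2 n3 n4 n5 n6 n7 n8 → R}
    (h : IsRep betaChar (zetaChar xi) (link lam mu nu gam) (skewGens n1 n2 n3 n4 n5 n6 n7 n8)
      ga gb gc gd x) ⦃p q : FreeAlgebra k (Gen n1 n2 n3 n4 n5 n6 n7 n8)⦄
    (hpq : Rel k xi n1 n2 n3 n4 n5 n6 n7 n8 lam mu nu gam p q) :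
    FreeAlgebra.lift k (genImage ga gb gc gd x) p =
      FreeAlgebra.lift k (genImage ga gb gc gd x) q := by
  have hmem : ∀ i ∈ skewGens n1 n2 n3 n4 n5 n6 n7 n8, i ∈ skewGens n1 n2 n3 n4 n5 n6 n7 n8 :=
    fun _ => id
  obtain ⟨mA, mB, mC, mD, mE, mF, mG, mH⟩ := forall_mem_skewGens.mp hmem
  have hadd : ∀ {i j} (r : k), i ∈ skewGens n1 n2 n3 n4 n5 n6 n7 n8 →
      j ∈ skewGens n1 n2 n3 n4 n5 n6 n7 n8 → betaChar i * betaChar j = (1 : k) →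
      link lam mu nu gam i j = r → x i * x j + x j * x i = r • (1 - gb * gc) := by
    intro i j r hi hj h1 h2
    simpa only [h1, h2, one_smul] using h.xx i hi j hj
  have hzero : ∀ {i j}, i ∈ skewGens n1 n2 n3 n4 n5 n6 n7 n8 →
      j ∈ skewGens n1 n2 n3 n4 n5 n6 n7 n8 → betaChar i * betaChar j = (1 : k) →
      link lam mu nu gam i j = 0 → x i * x j + x j * x i = 0 := by
    intro i j hi hj h1 h2
    simpa only [zero_smul] using hadd 0 hi hj h1 h2
  have hsub : ∀ {i j}, i ∈ skewGens n1 n2 n3 n4 n5 n6 n7 n8 →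
      j ∈ skewGens n1 n2 n3 n4 n5 n6 n7 n8 → betaChar i * betaChar j = (-1 : k) →
      link lam mu nu gam i j = 0 → x i * x j - x j * x i = 0 := by
    intro i j hi hj h1 h2
    simpa only [h1, h2, neg_smul, one_smul, zero_smul, ← sub_eq_add_neg] using h.xx i hi j hj
  have hpos : (1 : k) * 1 = 1 := one_mul 1
  have hneg : (-1 : k) * -1 = 1 := by ring
  have hmix : (1 : k) * -1 = -1 := one_mul (-1)
  cases hpq <;> simp only [map_mul, map_add, map_sub, map_neg, map_smul, map_one, map_zero,
    FreeAlgebra.lift_ι_apply, genImage]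
  case haa => exact h.aa
  case hbb => exact h.bb
  case hcc => exact h.cc
  case hab => exact h.ab
  case hac => exact h.ac
  case hbc => exact h.bc
  case hdd => exact h.dd
  case hda => exact h.da
  case hdb => exact h.db
  case hdc => exact h.dc
  case aA i => exact h.ax _ (mA i)
  case bA i => exact (h.bx _ (mA i)).trans (one_smul k _)
  case cA i => exact (h.cx _ (mA i)).trans (one_smul k _)
  case dA i => exact (h.dx _ (mA i)).trans (neg_smul xi _)
  case aB i => exact h.ax _ (mB i)
  case bB i => exact (h.bx _ (mB i)).trans (one_smul k _)
  case cB i => exact (h.cx _ (mB i)).trans (one_smul k _)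
  case dB i => exact h.dx _ (mB i)
  case aC i => exact h.ax _ (mC i)
  case bC i => exact (h.bx _ (mC i)).trans (one_smul k _)
  case cC i => exact (h.cx _ (mC i)).trans (one_smul k _)
  case dC i => exact (h.dx _ (mC i)).trans (neg_smul xi _)
  case aD i => exact h.ax _ (mD i)
  case bD i => exact (h.bx _ (mD i)).trans (one_smul k _)
  case cD i => exact (h.cx _ (mD i)).trans (one_smul k _)
  case dD i => exact h.dx _ (mD i)
  case aE i => exact h.ax _ (mE i)
  case bE i => exact (h.bx _ (mE i)).trans (neg_one_smul k _)
  case cE i => exact (h.cx _ (mE i)).trans (neg_one_smul k _)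
  case dE i => exact (h.dx _ (mE i)).trans (neg_smul xi _)
  case aF i => exact h.ax _ (mF i)
  case bF i => exact (h.bx _ (mF i)).trans (neg_one_smul k _)
  case cF i => exact (h.cx _ (mF i)).trans (neg_one_smul k _)
  case dF i => exact h.dx _ (mF i)
  case aG i => exact h.ax _ (mG i)
  case bG i => exact (h.bx _ (mG i)).trans (neg_one_smul k _)
  case cG i => exact (h.cx _ (mG i)).trans (neg_one_smul k _)
  case dG i => exact (h.dx _ (mG i)).trans (neg_smul xi _)
  case aH i => exact h.ax _ (mH i)
  case bH i => exact (h.bx _ (mH i)).trans (neg_one_smul k _)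
  case cH i => exact (h.cx _ (mH i)).trans (neg_one_smul k _)
  case dH i => exact h.dx _ (mH i)
  case AA i j => exact hzero (mA i) (mA j) hpos rfl
  case AB i j => exact hzero (mA i) (mB j) hpos rfl
  case AC i j => exact hzero (mA i) (mC j) hpos rfl
  case AD i j => exact hadd _ (mA i) (mD j) hpos rfl
  case AE i j => exact hsub (mA i) (mE j) hmix rfl
  case AF i j => exact hsub (mA i) (mF j) hmix rfl
  case AG i j => exact hsub (mA i) (mG j) hmix rfl
  case AH i j => exact hsub (mA i) (mH j) hmix rfl
  case BB i j => exact hzero (mB i) (mB j) hpos rfl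
  case BC i j => exact hadd _ (mB i) (mC j) hpos rfl
  case BD i j => exact hzero (mB i) (mD j) hpos rfl
  case BE i j => exact hsub (mB i) (mE j) hmix rfl
  case BF i j => exact hsub (mB i) (mF j) hmix rfl
  case BG i j => exact hsub (mB i) (mG j) hmix rfl
  case BH i j => exact hsub (mB i) (mH j) hmix rfl
  case CC i j => exact hzero (mC i) (mC j) hpos rfl
  case CD i j => exact hzero (mC i) (mD j) hpos rfl
  case CE i j => exact hsub (mC i) (mE j) hmix rfl
  case CF i j => exact hsub (mC i) (mF j) hmix rfl
  case CG i j => exact hsub (mC i) (mG j) hmix rfl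
  case CH i j => exact hsub (mC i) (mH j) hmix rfl
  case DD i j => exact hzero (mD i) (mD j) hpos rfl
  case DE i j => exact hsub (mD i) (mE j) hmix rfl
  case DF i j => exact hsub (mD i) (mF j) hmix rfl
  case DG i j => exact hsub (mD i) (mG j) hmix rfl
  case DH i j => exact hsub (mD i) (mH j) hmix rfl
  case EE i j => exact hzero (mE i) (mE j) hneg rfl
  case EF i j => exact hzero (mE i) (mF j) hneg rfl
  case EG i j => exact hzero (mE i) (mG j) hneg rfl
  case EH i j => exact hadd _ (mE i) (mH j) hneg rfl
  case FF i j => exact hzero (mF i) (mF j) hneg rfl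
  case FG i j => exact hadd _ (mF i) (mG j) hneg rfl
  case FH i j => exact hzero (mF i) (mH j) hneg rfl
  case GG i j => exact hzero (mG i) (mG j) hneg rfl
  case GH i j => exact hzero (mG i) (mH j) hneg rfl
  case HH i j => exact hzero (mH i) (mH j) hneg rfl

open Pointwise in
/-- A product of one element from each set `{1, y i}` is an ordered product of exponents `0, 1`. -/
lemma exists_pow_of_mem_prod_ofFn {n : ℕ} (y : Fin n → R) {t : R}
    (ht : t ∈ (List.ofFn fun i => ({1, y i} : Set R)).prod) :
    ∃ e : Fin n → Fin 2, (List.ofFn fun i => y i ^ (e i).val).prod = t := by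
  obtain ⟨z, rfl⟩ := Set.mem_prod_list_ofFn.mp ht
  have hz : ∀ i, ∃ e : Fin 2, y i ^ e.val = z i := by
    intro i
    rcases (z i).2 with h | h
    · exact ⟨0, by simpa using h.symm⟩
    · exact ⟨1, by simpa using h.symm⟩
  choose e he using hz
  exact ⟨e, by simp only [he]⟩

open Pointwise in
lemma exists_monomial_of_mem {t : R}
    (ht : t ∈ ((skewGens n1 n2 n3 n4 n5 n6 n7 n8).map
        fun i => ({1, f (g k i)} : Set R)).prod *
      IsRep.coreMonomials (f (g k a)) (f (g k b)) (f (g k c)) (f (g k d))) :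
    ∃ (eA : Fin n1 → Fin 2) (eB : Fin n2 → Fin 2) (eC : Fin n3 → Fin 2) (eD : Fin n4 → Fin 2)
      (eE : Fin n5 → Fin 2) (eF : Fin n6 → Fin 2) (eG : Fin n7 → Fin 2) (eH : Fin n8 → Fin 2)
      (ea eb ec ed : Fin 2),
      f ((List.ofFn fun i => g k (A i) ^ (eA i).val).prod *
        (List.ofFn fun j => g k (B j) ^ (eB j).val).prod *
        (List.ofFn fun i => g k (C i) ^ (eC i).val).prod *
        (List.ofFn fun l => g k (D l) ^ (eD l).val).prod *
        (List.ofFn fun m => g k (E m) ^ (eE m).val).prod *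
        (List.ofFn fun q => g k (F q) ^ (eF q).val).prod *
        (List.ofFn fun s => g k (G s) ^ (eG s).val).prod *
        (List.ofFn fun r => g k (H r) ^ (eH r).val).prod *
        g k a ^ ea.val * g k b ^ eb.val * g k c ^ ec.val * g k d ^ ed.val) = t := by
  obtain ⟨u, hu, _, ⟨⟨ea, eb, ec, ed⟩, rfl⟩, rfl⟩ := ht
  simp only [skewGens, List.map_append, List.prod_append, List.map_ofFn, Function.comp_def] at hu
  obtain ⟨_, ⟨_, ⟨_, ⟨_, ⟨_, ⟨_, ⟨_, hA, _, hB, rfl⟩, _, hC, rfl⟩, _, hD, rfl⟩, _, hE, rfl⟩,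
    _, hF, rfl⟩, _, hG, rfl⟩, _, hH, rfl⟩ := hu
  obtain ⟨eA, rfl⟩ := exists_pow_of_mem_prod_ofFn _ hA
  obtain ⟨eB, rfl⟩ := exists_pow_of_mem_prod_ofFn _ hB
  obtain ⟨eC, rfl⟩ := exists_pow_of_mem_prod_ofFn _ hC
  obtain ⟨eD, rfl⟩ := exists_pow_of_mem_prod_ofFn _ hD
  obtain ⟨eE, rfl⟩ := exists_pow_of_mem_prod_ofFn _ hE
  obtain ⟨eF, rfl⟩ := exists_pow_of_mem_prod_ofFn _ hF
  obtain ⟨eG, rfl⟩ := exists_pow_of_mem_prod_ofFn _ hG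
  obtain ⟨eH, rfl⟩ := exists_pow_of_mem_prod_ofFn _ hH
  refine ⟨eA, eB, eC, eD, eE, eF, eG, eH, ea, eb, ec, ed, ?_⟩
  simp only [map_mul, map_pow, map_list_prod, List.map_ofFn, Function.comp_def, mul_assoc]

/-- If the relations hold and the generators generate, the ordered span is everything. -/
lemma orderedSpan_eq_top [CharZero k] (hxi : xi * xi = -1) (hsurj : Function.Surjective f)
    (hf : ∀ p q, Rel k xi n1 n2 n3 n4 n5 n6 n7 n8 lam mu nu gam p q → f p = f q) :
    IsRep.orderedSpan (k := k) (f (g k a)) (f (g k b)) (f (g k c)) (f (g k d))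
      (fun i => f (g k i)) (skewGens n1 n2 n3 n4 n5 n6 n7 n8) = ⊤ := by
  have h := isRep_of_rel hxi hf
  have hD := isDatum xi hxi lam mu nu gam
  obtain ⟨mA, mB, mC, mD, mE, mF, mG, mH⟩ := forall_mem_skewGens.mp fun i hi =>
    fun t ht => h.x_mul_mem_orderedSpan hD (i := i) (t := t) hi ht
  have hgen : ∀ y : Gen n1 n2 n3 n4 n5 n6 n7 n8, ∀ t ∈ IsRep.orderedSpan (k := k) (f (g k a))
      (f (g k b)) (f (g k c)) (f (g k d)) (fun i => f (g k i))
      (skewGens n1 n2 n3 n4 n5 n6 n7 n8), f (g k y) * t ∈ IsRep.orderedSpan (k := k) (f (g k a))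
      (f (g k b)) (f (g k c)) (f (g k d)) (fun i => f (g k i))
      (skewGens n1 n2 n3 n4 n5 n6 n7 n8) := by
    intro y t ht
    cases y with
    | a =>
      exact IsRep.skew_mul_mem_orderedSpan _ (fun _ => (-1 : k))
        (fun i hi => (h.ax i hi).trans (neg_one_smul k _).symm) (fun _ => h.a_mul_mem_core) ht
    | b => exact IsRep.skew_mul_mem_orderedSpan _ _ h.bx (fun _ => h.b_mul_mem_core) ht
    | c => exact IsRep.skew_mul_mem_orderedSpan _ _ h.cx (fun _ => h.c_mul_mem_core) ht
    | d => exact IsRep.skew_mul_mem_orderedSpan _ _ h.dx (fun _ => h.d_mul_mem_core) ht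
    | A i => exact mA i t ht
    | B i => exact mB i t ht
    | C i => exact mC i t ht
    | D i => exact mD i t ht
    | E i => exact mE i t ht
    | F i => exact mF i t ht
    | G i => exact mG i t ht
    | H i => exact mH i t ht
  refine eq_top_iff.mpr fun u _ => ?_
  obtain ⟨p, rfl⟩ := hsurj u
  suffices hp : ∀ t ∈ IsRep.orderedSpan (k := k) (f (g k a))
      (f (g k b)) (f (g k c)) (f (g k d)) (fun i => f (g k i))
      (skewGens n1 n2 n3 n4 n5 n6 n7 n8), f p * t ∈ IsRep.orderedSpan (k := k) (f (g k a))
      (f (g k b)) (f (g k c)) (f (g k d)) (fun i => f (g k i))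
      (skewGens n1 n2 n3 n4 n5 n6 n7 n8) by
    simpa using hp 1 (IsRep.one_mem_orderedSpan _ _ _ _ _ _)
  induction p using FreeAlgebra.induction with
  | grade0 r =>
    intro t ht
    rw [AlgHom.commutes, ← Algebra.smul_def]
    exact Submodule.smul_mem _ _ ht
  | grade1 y => exact hgen y
  | mul p q hp hq =>
    intro t ht
    rw [map_mul, mul_assoc]
    exact hp trivial _ (hq trivial t ht)
  | add p q hp hq =>
    intro t ht
    rw [map_add, add_mul]
    exact add_mem (hp trivial t ht) (hq trivial t ht)

end Parameters

lemma span_range_mono [CharZero k] (xi : k) (hxi : xi * xi = -1) (n1 n2 n3 n4 n5 n6 n7 n8 : ℕ)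
    (lam : Matrix (Fin n1) (Fin n4) k) (mu : Matrix (Fin n2) (Fin n3) k)
    (nu : Matrix (Fin n5) (Fin n8) k) (gam : Matrix (Fin n6) (Fin n7) k) :
    Submodule.span k (Set.range (mono k xi n1 n2 n3 n4 n5 n6 n7 n8 lam mu nu gam)) = ⊤ := by
  refine eq_top_iff.mpr ?_
  rw [← orderedSpan_eq_top (f := mk k xi n1 n2 n3 n4 n5 n6 n7 n8 lam mu nu gam) hxi
    (RingQuot.mkAlgHom_surjective k _) fun _ _ h => RingQuot.mkAlgHom_rel k h]
  refine (IsRep.orderedSpan_le _ _ _ _ _ _).trans (Submodule.span_mono fun t ht => ?_)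
  obtain ⟨eA, eB, eC, eD, eE, eF, eG, eH, ea, eb, ec, ed, h⟩ := exists_monomial_of_mem ht
  exact ⟨(eA, eB, eC, eD, eE, eF, eG, eH, ea, eb, ec, ed), h⟩

lemma le_finrank {k : Type u} [Field k] (xi : k) (hxi : xi * xi = -1)
    (n1 n2 n3 n4 n5 n6 n7 n8 : ℕ)
    (lam : Matrix (Fin n1) (Fin n4) k) (mu : Matrix (Fin n2) (Fin n3) k)
    (nu : Matrix (Fin n5) (Fin n8) k) (gam : Matrix (Fin n6) (Fin n7) k)
    [FiniteDimensional k (U k xi n1 n2 n3 n4 n5 n6 n7 n8 lam mu nu gam)] :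
    2 ^ (4 + (n1 + n2 + n3 + n4 + n5 + n6 + n7 + n8)) ≤
      Module.finrank k (U k xi n1 n2 n3 n4 n5 n6 n7 n8 lam mu nu gam) := by
  have hζ : ∀ i : Gen n1 n2 n3 n4 n5 n6 n7 n8, zetaChar xi i * zetaChar xi i = -1 := by
    intro i
    cases i <;> simp [zetaChar, hxi]
  obtain ⟨W, _, _, ga, gb, gc, gd, x, v, h, hcyc, _, hdim⟩ :=
    IsRep.exists_isCyclic (isDatum xi hxi lam mu nu gam) hζ nodup_skewGens
  let φ : U k xi n1 n2 n3 n4 n5 n6 n7 n8 lam mu nu gam →ₐ[k] Module.End k W :=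
    RingQuot.liftAlgHom k ⟨FreeAlgebra.lift k (genImage ga gb gc gd x), h.lift_eq_of_rel⟩
  have hφ : ∀ y, φ (mk k xi n1 n2 n3 n4 n5 n6 n7 n8 lam mu nu gam (g k y)) =
      genImage ga gb gc gd x y := fun y => by
    rw [RingQuot.liftAlgHom_mkAlgHom_apply, FreeAlgebra.lift_ι_apply]
  let ev := (LinearMap.applyₗ v : Module.End k W →ₗ[k] W) ∘ₗ φ.toLinearMap
  have hclosed : ∀ y, ∀ w ∈ LinearMap.range ev,
      genImage ga gb gc gd x y w ∈ LinearMap.range ev := by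
    rintro y _ ⟨u, rfl⟩
    refine ⟨mk k xi n1 n2 n3 n4 n5 n6 n7 n8 lam mu nu gam (g k y) * u, ?_⟩
    change φ (_ * u) v = genImage ga gb gc gd x y (φ u v)
    rw [map_mul, hφ, Module.End.mul_apply]
  have htop : LinearMap.range ev = ⊤ := by
    refine hcyc _ ⟨1, ?_⟩ (hclosed a) (hclosed b) (hclosed c) (hclosed d)
      (forall_mem_skewGens.mpr ⟨fun i => hclosed (A i), fun i => hclosed (B i),
        fun i => hclosed (C i), fun i => hclosed (D i), fun i => hclosed (E i),
        fun i => hclosed (F i), fun i => hclosed (G i), fun i => hclosed (H i)⟩)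
    change φ 1 v = v
    rw [map_one, Module.End.one_apply]
  rw [← length_skewGens, ← hdim]
  exact LinearMap.finrank_le_finrank_of_surjective (LinearMap.range_eq_top.mp htop)


end Presentation

theorem thm [IsAlgClosed k] [CharZero k] (xi : k) (hxi : IsPrimitiveRoot xi 4)
    (n1 n2 n3 n4 n5 n6 n7 n8 : ℕ)
    (hn : 1 ≤ n1 + n2 + n3 + n4 + n5 + n6 + n7 + n8)
    (lam : Matrix (Fin n1) (Fin n4) k) (mu : Matrix (Fin n2) (Fin n3) k)
    (nu : Matrix (Fin n5) (Fin n8) k) (gam : Matrix (Fin n6) (Fin n7) k) :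
    Module.finrank k (U k xi n1 n2 n3 n4 n5 n6 n7 n8 lam mu nu gam) = 2 ^ (4 + (n1 + n2 + n3 + n4 + n5 + n6 + n7 + n8)) ∧
    LinearIndependent k (mono k xi n1 n2 n3 n4 n5 n6 n7 n8 lam mu nu gam) ∧
    Submodule.span k (Set.range (mono k xi n1 n2 n3 n4 n5 n6 n7 n8 lam mu nu gam)) = ⊤ := by
  have hxi' : xi * xi = -1 := by
    have h1 : (xi * xi - 1) * (xi * xi + 1) = 0 := by linear_combination hxi.pow_eq_one
    have h2 : xi * xi - 1 ≠ 0 := fun h =>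
      hxi.pow_ne_one_of_pos_of_lt two_ne_zero (by norm_num) (by linear_combination h)
    exact eq_neg_of_add_eq_zero_left ((mul_eq_zero.mp h1).resolve_left h2)
  have hspan := span_range_mono xi hxi' n1 n2 n3 n4 n5 n6 n7 n8 lam mu nu gam
  have : FiniteDimensional k (U k xi n1 n2 n3 n4 n5 n6 n7 n8 lam mu nu gam) :=
    ⟨Submodule.fg_def.mpr ⟨_, Set.finite_range _, hspan⟩⟩
  have hcard : Fintype.card ((Fin n1 → Fin 2) × (Fin n2 → Fin 2) × (Fin n3 → Fin 2) ×
      (Fin n4 → Fin 2) × (Fin n5 → Fin 2) × (Fin n6 → Fin 2) × (Fin n7 → Fin 2) ×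
      (Fin n8 → Fin 2) × Fin 2 × Fin 2 × Fin 2 × Fin 2) =
      2 ^ (4 + (n1 + n2 + n3 + n4 + n5 + n6 + n7 + n8)) := by
    simp only [Fintype.card_prod, Fintype.card_pi, Fintype.card_fin, Finset.prod_const,
      Finset.card_univ]
    ring
  have hle := finrank_range_le_card (R := k) (mono k xi n1 n2 n3 n4 n5 n6 n7 n8 lam mu nu gam)
  rw [Set.finrank, hspan, finrank_top, hcard] at hle
  have hdim := hle.antisymm (le_finrank xi hxi' n1 n2 n3 n4 n5 n6 n7 n8 lam mu nu gam)
  exact ⟨hdim, linearIndependent_of_top_le_span_of_card_eq_finrank hspan.ge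
    (hcard.trans hdim.symm), hspan⟩

end Stmt3
end

section
/- For all n1, n2, n3, n4 ∈ ℕ and all parameters ν = (ν_{mr}) ∈ k^{n1×n4}, γ = (γ_{qs}) ∈ k^{n2×n3}, λ ∈ k, the algebra U_2(n1,n2,n3,n4; ν,γ,λ) has dimension 2^{6+n1+n2+n3+n4} over k; a k-basis is given by the images of the products p1^{i} p2^{j} (∏_m E_m^{ε_m})(∏_q F_q^{φ_q})(∏_s G_s^{σ_s})(∏_r H_r^{ρ_r}) a^e b^f c^g d^h with all exponents in {0,1} and factors taken in increasing index order. -/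
namespace Stmt4

/-- The generators `a, b, c, d, p1, p2` and the families `E, F, G, H`. -/
inductive Gen (n1 n2 n3 n4 : ℕ)
  | a | b | c | d | p1 | p2
  | E (m : Fin n1) | F (q : Fin n2) | G (s : Fin n3) | H (r : Fin n4)

open Gen

variable (k : Type*) [Field k]
variable (xi : k) (n1 n2 n3 n4 : ℕ) (nu : Matrix (Fin n1) (Fin n4) k)
  (gam : Matrix (Fin n2) (Fin n3) k) (lam : k)

/-- The generators viewed inside the free algebra. -/
abbrev g {n1 n2 n3 n4 : ℕ} (x : Gen n1 n2 n3 n4) : FreeAlgebra k (Gen n1 n2 n3 n4) :=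
  FreeAlgebra.ι k x

/-- The defining relations of `U_2(n1,n2,n3,n4; ν,γ,λ)`. -/
inductive Rel : FreeAlgebra k (Gen n1 n2 n3 n4) → FreeAlgebra k (Gen n1 n2 n3 n4) → Prop
  -- H-relations
  | haa : Rel (g k a * g k a) 1
  | hbb : Rel (g k b * g k b) 1
  | hcc : Rel (g k c * g k c) 1
  | hab : Rel (g k a * g k b) (g k b * g k a)
  | hac : Rel (g k a * g k c) (g k c * g k a)
  | hbc : Rel (g k b * g k c) (g k c * g k b)
  | hdd : Rel (g k d * g k d) (g k a)
  | hda : Rel (g k d * g k a) (g k a * g k d)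
  | hdb : Rel (g k d * g k b) (g k c * g k d)
  | hdc : Rel (g k d * g k c) (g k b * g k d)
  | aE (m : Fin n1) : Rel (g k a * g k (E m)) (-(g k (E m) * g k a))
  | bE (m : Fin n1) : Rel (g k b * g k (E m)) (-(g k (E m) * g k b))
  | cE (m : Fin n1) : Rel (g k c * g k (E m)) (-(g k (E m) * g k c))
  | dE (m : Fin n1) : Rel (g k d * g k (E m)) (-(xi • (g k (E m) * g k d)))
  | aF (q : Fin n2) : Rel (g k a * g k (F q)) (-(g k (F q) * g k a))
  | bF (q : Fin n2) : Rel (g k b * g k (F q)) (-(g k (F q) * g k b))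
  | cF (q : Fin n2) : Rel (g k c * g k (F q)) (-(g k (F q) * g k c))
  | dF (q : Fin n2) : Rel (g k d * g k (F q)) (xi • (g k (F q) * g k d))
  | aG (s : Fin n3) : Rel (g k a * g k (G s)) (-(g k (G s) * g k a))
  | bG (s : Fin n3) : Rel (g k b * g k (G s)) (-(g k (G s) * g k b))
  | cG (s : Fin n3) : Rel (g k c * g k (G s)) (-(g k (G s) * g k c))
  | dG (s : Fin n3) : Rel (g k d * g k (G s)) (-(xi • (g k (G s) * g k d)))
  | aH (r : Fin n4) : Rel (g k a * g k (H r)) (-(g k (H r) * g k a))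
  | bH (r : Fin n4) : Rel (g k b * g k (H r)) (-(g k (H r) * g k b))
  | cH (r : Fin n4) : Rel (g k c * g k (H r)) (-(g k (H r) * g k c))
  | dH (r : Fin n4) : Rel (g k d * g k (H r)) (xi • (g k (H r) * g k d))
  | EE (i i' : Fin n1) : Rel (g k (E i) * g k (E i') + g k (E i') * g k (E i)) (0)
  | FF (i i' : Fin n2) : Rel (g k (F i) * g k (F i') + g k (F i') * g k (F i)) (0)
  | GG (i i' : Fin n3) : Rel (g k (G i) * g k (G i') + g k (G i') * g k (G i)) (0)
  | HH (i i' : Fin n4) : Rel (g k (H i) * g k (H i') + g k (H i') * g k (H i)) (0)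
  | EH (i : Fin n1) (i' : Fin n4) : Rel (g k (E i) * g k (H i') + g k (H i') * g k (E i)) (nu i i' • (1 - g k b * g k c))
  | FG (i : Fin n2) (i' : Fin n3) : Rel (g k (F i) * g k (G i') + g k (G i') * g k (F i)) (gam i i' • (1 - g k b * g k c))
  | EF (i : Fin n1) (i' : Fin n2) : Rel (g k (E i) * g k (F i') + g k (F i') * g k (E i)) (0)
  | EG (i : Fin n1) (i' : Fin n3) : Rel (g k (E i) * g k (G i') + g k (G i') * g k (E i)) (0)
  | FH (i : Fin n2) (i' : Fin n4) : Rel (g k (F i) * g k (H i') + g k (H i') * g k (F i)) (0)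
  | GH (i : Fin n3) (i' : Fin n4) : Rel (g k (G i) * g k (H i') + g k (H i') * g k (G i)) (0)
  -- relations involving p1, p2
  | ap1 : Rel (g k a * g k p1) (g k p1 * g k a)
  | bp1 : Rel (g k b * g k p1) (-(g k p1 * g k b))
  | cp1 : Rel (g k c * g k p1) (-(g k p1 * g k c))
  | dp1 : Rel (g k d * g k p1) (g k p2 * g k d)
  | ap2 : Rel (g k a * g k p2) (g k p2 * g k a)
  | bp2 : Rel (g k b * g k p2) (-(g k p2 * g k b))
  | cp2 : Rel (g k c * g k p2) (-(g k p2 * g k c))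
  | dp2 : Rel (g k d * g k p2) (g k p1 * g k d)
  | p1p1 : Rel (g k p1 * g k p1) 0
  | p2p2 : Rel (g k p2 * g k p2) 0
  | p1p2 : Rel (g k p1 * g k p2 + g k p2 * g k p1) (lam • (1 - g k b * g k c))
  | p1E (i : Fin n1) : Rel (g k p1 * g k (E i) + g k (E i) * g k p1) (0)
  | p2E (i : Fin n1) : Rel (g k p2 * g k (E i) + g k (E i) * g k p2) (0)
  | p1F (i : Fin n2) : Rel (g k p1 * g k (F i) + g k (F i) * g k p1) (0)
  | p2F (i : Fin n2) : Rel (g k p2 * g k (F i) + g k (F i) * g k p2) (0)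
  | p1G (i : Fin n3) : Rel (g k p1 * g k (G i) + g k (G i) * g k p1) (0)
  | p2G (i : Fin n3) : Rel (g k p2 * g k (G i) + g k (G i) * g k p2) (0)
  | p1H (i : Fin n4) : Rel (g k p1 * g k (H i) + g k (H i) * g k p1) (0)
  | p2H (i : Fin n4) : Rel (g k p2 * g k (H i) + g k (H i) * g k p2) (0)

/-- The algebra `U_2(n1,n2,n3,n4; ν,γ,λ)`. -/
abbrev U := RingQuot (Rel k xi n1 n2 n3 n4 nu gam lam)

/-- The quotient map. -/
noncomputable abbrev mk : FreeAlgebra k (Gen n1 n2 n3 n4) →ₐ[k] U k xi n1 n2 n3 n4 nu gam lam :=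
  RingQuot.mkAlgHom k (Rel k xi n1 n2 n3 n4 nu gam lam)

/-- The image of the monomial
`p1^i p2^j (∏ E_m^{ε_m})(∏ F_q^{φ_q})(∏ G_s^{σ_s})(∏ H_r^{ρ_r}) a^e b^f c^g d^h`,
with factors of each family taken in increasing index order. -/
noncomputable def mono
    (x : (Fin 2 × Fin 2) × (Fin n1 → Fin 2) × (Fin n2 → Fin 2) × (Fin n3 → Fin 2) ×
      (Fin n4 → Fin 2) × Fin 2 × Fin 2 × Fin 2 × Fin 2) : U k xi n1 n2 n3 n4 nu gam lam :=
  match x with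
  | ⟨⟨i, j⟩, eE, eF, eG, eH, ea, eb, ec, ed⟩ =>
    mk k xi n1 n2 n3 n4 nu gam lam
      (g k p1 ^ i.val * g k p2 ^ j.val *
        (List.ofFn fun m => g k (E m) ^ (eE m).val).prod *
        (List.ofFn fun q => g k (F q) ^ (eF q).val).prod *
        (List.ofFn fun s => g k (G s) ^ (eG s).val).prod *
        (List.ofFn fun r => g k (H r) ^ (eH r).val).prod *
        g k a ^ ea.val * g k b ^ eb.val * g k c ^ ec.val * g k d ^ ed.val)

section Spanning

variable {A : Type*} [Ring A] {K : Type*} [Field K] [Algebra K A]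

/-- The span of `1` and `x`. -/
def powSpan (K : Type*) [Field K] {A : Type*} [Ring A] [Algebra K A] (x : A) : Submodule K A :=
  Submodule.span K (Set.range fun i : Fin 2 => x ^ i.val)

/-- `S` is closed under multiplication by `y` on the right. -/
def RightStable (S : Submodule K A) (y : A) : Prop := ∀ s ∈ S, s * y ∈ S

lemma one_mem_powSpan (x : A) : 1 ∈ powSpan K x :=
  Submodule.subset_span ⟨0, by simp⟩

lemma self_mem_powSpan (x : A) : x ∈ powSpan K x :=
  Submodule.subset_span ⟨1, by simp⟩

lemma exists_of_mem_mul_powSpan {S : Submodule K A} {x t : A} (ht : t ∈ S * powSpan K x) :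
    ∃ s ∈ S, ∃ s' ∈ S, t = s + s' * x := by
  induction ht using Submodule.mul_induction_on' with
  | mem_mul_mem s hs p hp =>
    have hp' : p ∈ Submodule.span K {1, x} := by
      refine Submodule.span_mono ?_ hp
      rintro _ ⟨i, rfl⟩
      fin_cases i <;> simp
    obtain ⟨u, v, rfl⟩ := Submodule.mem_span_pair.1 hp'
    exact ⟨u • s, S.smul_mem _ hs, v • s, S.smul_mem _ hs, by simp [mul_add]⟩
  | add t₁ _ t₂ _ h₁ h₂ =>
    obtain ⟨s₁, hs₁, r₁, hr₁, rfl⟩ := h₁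
    obtain ⟨s₂, hs₂, r₂, hr₂, rfl⟩ := h₂
    exact ⟨s₁ + s₂, S.add_mem hs₁ hs₂, r₁ + r₂, S.add_mem hr₁ hr₂, by noncomm_ring⟩

lemma add_mul_mem_mul_powSpan {S : Submodule K A} {x s s' : A} (hs : s ∈ S) (hs' : s' ∈ S) :
    s + s' * x ∈ S * powSpan K x :=
  add_mem (by simpa using Submodule.mul_mem_mul hs (one_mem_powSpan (K := K) x))
    (Submodule.mul_mem_mul hs' (self_mem_powSpan x))

lemma le_mul_powSpan (S : Submodule K A) (x : A) : S ≤ S * powSpan K x := fun s hs => by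
  simpa using add_mul_mem_mul_powSpan (x := x) hs S.zero_mem

lemma one_mem_prod_powSpan (l : List A) : 1 ∈ (l.map (powSpan K)).prod := by
  induction l with
  | nil => exact Submodule.mem_one.2 ⟨1, map_one _⟩
  | cons x l ih => simpa using Submodule.mul_mem_mul (one_mem_powSpan (K := K) x) ih

lemma rightStable_one (S : Submodule K A) : RightStable S 1 := fun s hs => by simpa using hs

lemma rightStable_zero (S : Submodule K A) : RightStable S 0 := fun s _ => by simp

namespace RightStable

variable {S : Submodule K A} {x y y' z : A}

lemma smul (h : RightStable S y) (c : K) : RightStable S (c • y) := fun s hs => by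
  simpa using S.smul_mem c (h s hs)

lemma mul (h : RightStable S y) (h' : RightStable S y') : RightStable S (y * y') := fun s hs => by
  simpa [mul_assoc] using h' _ (h s hs)

lemma mul_powSpan_self (h : RightStable S (y * y)) : RightStable (S * powSpan K y) y := by
  intro t ht
  obtain ⟨s, hs, s', hs', rfl⟩ := exists_of_mem_mul_powSpan ht
  convert add_mul_mem_mul_powSpan (x := y) (h s' hs') hs using 1
  noncomm_ring

lemma mul_powSpan (h : RightStable S y) (h' : RightStable S y') (hxy : x * y = y' * x) :
    RightStable (S * powSpan K x) y := by
  intro t ht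
  obtain ⟨s, hs, s', hs', rfl⟩ := exists_of_mem_mul_powSpan ht
  convert add_mul_mem_mul_powSpan (x := x) (h s hs) (h' s' hs') using 1
  rw [add_mul, mul_assoc s', hxy, mul_assoc]

lemma mul_powSpan_of_anticomm (h : RightStable S y) (hz : RightStable S z) {c : K}
    (hxy : x * y + y * x = c • (1 - z)) : RightStable (S * powSpan K x) y := by
  intro t ht
  obtain ⟨s, hs, s', hs', rfl⟩ := exists_of_mem_mul_powSpan ht
  have hs'' : s * y + c • (s' - s' * z) ∈ S :=
    S.add_mem (h s hs) (S.smul_mem _ (S.sub_mem hs' (hz s' hs')))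
  convert add_mul_mem_mul_powSpan (x := x) hs'' (S.neg_mem (h s' hs')) using 1
  rw [add_mul, mul_assoc s', eq_sub_of_add_eq hxy]
  simp [mul_sub]
  noncomm_ring

end RightStable

/-- Products of `powSpan`s of elements anticommuting up to multiples of `1 - z`, with `z` central
among them, are closed under right multiplication by these elements. -/
lemma rightStable_prod_powSpan {z : A} (hz : z * z = 1) (l : List A)
    (hzl : ∀ x ∈ l, x * z = z * x) (hsq : ∀ x ∈ l, x * x = 0)
    (hl : ∀ x ∈ l, ∀ y ∈ l, ∃ c : K, x * y + y * x = c • (1 - z)) :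
    RightStable (powSpan K z * (l.map (powSpan K)).prod) z ∧
      ∀ x ∈ l, RightStable (powSpan K z * (l.map (powSpan K)).prod) x := by
  induction l using List.reverseRecOn with
  | nil =>
    have := RightStable.mul_powSpan_self (S := (1 : Submodule K A)) (y := z)
      (hz ▸ rightStable_one _)
    simpa using this
  | append_singleton l y ih =>
    obtain ⟨ihz, ihx⟩ := ih (fun x hx => hzl x (by simp [hx])) (fun x hx => hsq x (by simp [hx]))
      (fun x hx y hy => hl x (by simp [hx]) y (by simp [hy]))
    simp only [List.map_append, List.prod_append, List.map_cons, List.map_nil, List.prod_singleton,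
      ← mul_assoc]
    refine ⟨ihz.mul_powSpan ihz (hzl y (by simp)), fun x hx => ?_⟩
    rcases List.mem_append.1 hx with hx | hx
    · obtain ⟨c, hc⟩ := hl y (by simp) x (by simp [hx])
      exact (ihx x hx).mul_powSpan_of_anticomm ihz hc
    · obtain rfl := List.mem_singleton.1 hx
      exact RightStable.mul_powSpan_self (by rw [hsq x (by simp)]; exact rightStable_zero _)

lemma span_range_mul_span_range {α β : Type*} (f : α → A) (h : β → A) :
    Submodule.span K (Set.range f) * Submodule.span K (Set.range h) =
      Submodule.span K (Set.range fun p : α × β => f p.1 * h p.2) := by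
  rw [Submodule.span_mul_span]
  congr 1
  ext t
  simp [Set.mem_mul]

lemma prod_ofFn_powSpan {n : ℕ} (x : Fin n → A) :
    (List.ofFn fun m => powSpan K (x m)).prod =
      Submodule.span K (Set.range fun ε : Fin n → Fin 2 =>
        (List.ofFn fun m => x m ^ (ε m).val).prod) := by
  induction n with
  | zero => simp [Submodule.one_eq_span]
  | succ n ih =>
    rw [List.ofFn_succ, List.prod_cons, ih, powSpan, span_range_mul_span_range]
    congr 1
    rw [← (Fin.consEquiv fun _ : Fin (n + 1) => Fin 2).surjective.range_comp]
    congr 1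
    ext p
    simp [List.ofFn_succ]

end Spanning

section Generation

variable {k xi n1 n2 n3 n4 nu gam lam}

variable {A : Type*} [Ring A] [Algebra k A] {f : FreeAlgebra k (Gen n1 n2 n3 n4) →ₐ[k] A}

/-- The generators other than `a, b, c, d`. -/
def vecGens (n1 n2 n3 n4 : ℕ) : List (Gen n1 n2 n3 n4) :=
  [p1, p2] ++ List.ofFn E ++ List.ofFn F ++ List.ofFn G ++ List.ofFn H

lemma mem_vecGens (x : Gen n1 n2 n3 n4) :
    x ∈ vecGens n1 n2 n3 n4 ∨ x = a ∨ x = b ∨ x = c ∨ x = d := by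
  cases x <;> simp [vecGens]

lemma vecGens_cases {P : Gen n1 n2 n3 n4 → Prop} (hp1 : P p1) (hp2 : P p2) (hE : ∀ m, P (E m))
    (hF : ∀ q, P (F q)) (hG : ∀ s, P (G s)) (hH : ∀ r, P (H r)) :
    ∀ x ∈ vecGens n1 n2 n3 n4, P x := by
  intro x hx
  simp only [vecGens, List.mem_append, List.mem_ofFn, List.mem_cons, List.not_mem_nil,
    or_false] at hx
  grind

lemma map_mul_self
    (hf : ∀ ⦃x y⦄, Rel k xi n1 n2 n3 n4 nu gam lam x y → f x = f y)
    (h2 : (2 : k) ≠ 0) : ∀ x ∈ vecGens n1 n2 n3 n4, f (g k x) * f (g k x) = 0 := by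
  have key (t : A) (h : t + t = 0) : t = 0 := by
    rw [← two_smul k] at h
    exact (smul_eq_zero.1 h).resolve_left h2
  refine vecGens_cases ?_ ?_ (fun m => key _ ?_) (fun m => key _ ?_) (fun m => key _ ?_)
    (fun m => key _ ?_)
  · simpa using hf .p1p1
  · simpa using hf .p2p2
  · simpa using hf (.EE m m)
  · simpa using hf (.FF m m)
  · simpa using hf (.GG m m)
  · simpa using hf (.HH m m)

lemma map_anticomm
    (hf : ∀ ⦃x y⦄, Rel k xi n1 n2 n3 n4 nu gam lam x y → f x = f y)
    (h2 : (2 : k) ≠ 0) : ∀ x ∈ vecGens n1 n2 n3 n4, ∀ y ∈ vecGens n1 n2 n3 n4,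
    ∃ t : k, f (g k x) * f (g k y) + f (g k y) * f (g k x) = t • (1 - f (g k b) * f (g k c)) := by
  have zero {x y : Gen n1 n2 n3 n4}
      (h : Rel k xi n1 n2 n3 n4 nu gam lam (g k x * g k y + g k y * g k x) 0) :
      ∃ t : k, f (g k x) * f (g k y) + f (g k y) * f (g k x) = t • (1 - f (g k b) * f (g k c)) :=
    ⟨0, by simpa using hf h⟩
  have rel {x y : Gen n1 n2 n3 n4} {t : k} (h : Rel k xi n1 n2 n3 n4 nu gam lam
      (g k x * g k y + g k y * g k x) (t • (1 - g k b * g k c))) :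
      ∃ t : k, f (g k x) * f (g k y) + f (g k y) * f (g k x) = t • (1 - f (g k b) * f (g k c)) :=
    ⟨t, by simpa using hf h⟩
  have swap {x y : Gen n1 n2 n3 n4}
      (h : ∃ t : k, f (g k x) * f (g k y) + f (g k y) * f (g k x) = t • (1 - f (g k b) * f (g k c))) :
      ∃ t : k, f (g k y) * f (g k x) + f (g k x) * f (g k y) = t • (1 - f (g k b) * f (g k c)) := by
    simpa only [add_comm] using h
  have self {x : Gen n1 n2 n3 n4} (hx : x ∈ vecGens n1 n2 n3 n4) :
      ∃ t : k, f (g k x) * f (g k x) + f (g k x) * f (g k x) = t • (1 - f (g k b) * f (g k c)) :=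
    ⟨0, by simp [map_mul_self hf h2 x hx]⟩
  refine vecGens_cases ?_ ?_ ?_ ?_ ?_ ?_
  · exact vecGens_cases (self (by simp [vecGens])) (rel .p1p2) (fun m => zero (.p1E m))
      (fun m => zero (.p1F m)) (fun m => zero (.p1G m)) (fun m => zero (.p1H m))
  · exact vecGens_cases (swap (rel .p1p2)) (self (by simp [vecGens])) (fun m => zero (.p2E m))
      (fun m => zero (.p2F m)) (fun m => zero (.p2G m)) (fun m => zero (.p2H m))
  · exact fun i => vecGens_cases (swap (zero (.p1E i))) (swap (zero (.p2E i)))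
      (fun m => zero (.EE i m)) (fun m => zero (.EF i m)) (fun m => zero (.EG i m))
      (fun m => rel (.EH i m))
  · exact fun i => vecGens_cases (swap (zero (.p1F i))) (swap (zero (.p2F i)))
      (fun m => swap (zero (.EF m i))) (fun m => zero (.FF i m)) (fun m => rel (.FG i m))
      (fun m => zero (.FH i m))
  · exact fun i => vecGens_cases (swap (zero (.p1G i))) (swap (zero (.p2G i)))
      (fun m => swap (zero (.EG m i))) (fun m => swap (rel (.FG m i))) (fun m => zero (.GG i m))
      (fun m => zero (.GH i m))
  · exact fun i => vecGens_cases (swap (zero (.p1H i))) (swap (zero (.p2H i)))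
      (fun m => swap (rel (.EH m i))) (fun m => swap (zero (.FH m i)))
      (fun m => swap (zero (.GH m i))) (fun m => zero (.HH i m))

lemma map_a_mul
    (hf : ∀ ⦃x y⦄, Rel k xi n1 n2 n3 n4 nu gam lam x y → f x = f y) :
    ∀ x ∈ vecGens n1 n2 n3 n4, ∃ t : k, f (g k a) * f (g k x) = (t • f (g k x)) * f (g k a) := by
  refine vecGens_cases ⟨1, ?_⟩ ⟨1, ?_⟩ (fun m => ⟨-1, ?_⟩) (fun m => ⟨-1, ?_⟩) (fun m => ⟨-1, ?_⟩)
    (fun m => ⟨-1, ?_⟩)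
  · simpa using hf .ap1
  · simpa using hf .ap2
  · simpa using hf (.aE m)
  · simpa using hf (.aF m)
  · simpa using hf (.aG m)
  · simpa using hf (.aH m)

lemma map_b_mul
    (hf : ∀ ⦃x y⦄, Rel k xi n1 n2 n3 n4 nu gam lam x y → f x = f y) :
    ∀ x ∈ vecGens n1 n2 n3 n4, f (g k b) * f (g k x) = -(f (g k x) * f (g k b)) := by
  refine vecGens_cases ?_ ?_ (fun m => ?_) (fun m => ?_) (fun m => ?_) (fun m => ?_)
  · simpa using hf .bp1
  · simpa using hf .bp2
  · simpa using hf (.bE m)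
  · simpa using hf (.bF m)
  · simpa using hf (.bG m)
  · simpa using hf (.bH m)

lemma map_c_mul
    (hf : ∀ ⦃x y⦄, Rel k xi n1 n2 n3 n4 nu gam lam x y → f x = f y) :
    ∀ x ∈ vecGens n1 n2 n3 n4, f (g k c) * f (g k x) = -(f (g k x) * f (g k c)) := by
  refine vecGens_cases ?_ ?_ (fun m => ?_) (fun m => ?_) (fun m => ?_) (fun m => ?_)
  · simpa using hf .cp1
  · simpa using hf .cp2
  · simpa using hf (.cE m)
  · simpa using hf (.cF m)
  · simpa using hf (.cG m)
  · simpa using hf (.cH m)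

lemma map_d_mul
    (hf : ∀ ⦃x y⦄, Rel k xi n1 n2 n3 n4 nu gam lam x y → f x = f y) :
    ∀ x ∈ vecGens n1 n2 n3 n4, ∃ t : k, ∃ y ∈ vecGens n1 n2 n3 n4,
    f (g k d) * f (g k x) = (t • f (g k y)) * f (g k d) := by
  refine vecGens_cases ⟨1, p2, by simp [vecGens], ?_⟩ ⟨1, p1, by simp [vecGens], ?_⟩
    (fun m => ⟨-xi, E m, by simp [vecGens], ?_⟩) (fun m => ⟨xi, F m, by simp [vecGens], ?_⟩)
    (fun m => ⟨-xi, G m, by simp [vecGens], ?_⟩) (fun m => ⟨xi, H m, by simp [vecGens], ?_⟩)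
  · simpa using hf .dp1
  · simpa using hf .dp2
  · simpa using hf (.dE m)
  · simpa using hf (.dF m)
  · simpa using hf (.dG m)
  · simpa using hf (.dH m)

/-- A right-stable submodule containing `1` is everything. -/
lemma eq_top_of_rightStable (hsurj : Function.Surjective f) {S : Submodule k A} (h1 : 1 ∈ S)
    (h : ∀ x, RightStable S (f (g k x))) : S = ⊤ := by
  refine Submodule.eq_top_iff'.2 fun u => ?_
  obtain ⟨w, rfl⟩ := hsurj u
  suffices ∀ w : FreeAlgebra k (Gen n1 n2 n3 n4),
      RightStable S (f w) by
    simpa using this w 1 h1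
  intro w
  induction w using FreeAlgebra.induction with
  | grade0 r =>
    rw [AlgHom.commutes, Algebra.algebraMap_eq_smul_one]
    exact (rightStable_one S).smul r
  | grade1 x => exact h x
  | mul v w hv hw => rw [map_mul]; exact hv.mul hw
  | add v w hv hw =>
    intro s hs
    rw [map_add, mul_add]
    exact S.add_mem (hv s hs) (hw s hs)

lemma map_mul_bc
    (hf : ∀ ⦃x y⦄, Rel k xi n1 n2 n3 n4 nu gam lam x y → f x = f y) (x : Gen n1 n2 n3 n4) :
    f (g k x) * (f (g k b) * f (g k c)) = (f (g k b) * f (g k c)) * f (g k x) := by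
  have hab := hf Rel.hab
  have hac := hf Rel.hac
  have hbc := hf Rel.hbc
  have hdb := hf Rel.hdb
  have hdc := hf Rel.hdc
  simp only [map_mul] at hab hac hbc hdb hdc
  rcases mem_vecGens x with hx | rfl | rfl | rfl | rfl
  · have hb := map_b_mul hf x hx
    have hc := map_c_mul hf x hx
    rw [mul_assoc, hc, mul_neg, ← mul_assoc, ← mul_assoc, hb, neg_mul, neg_neg]
  · grind
  · grind
  · grind
  · grind

/-- The span of the monomials, written as a product, is everything. -/
lemma prod_powSpan_eq_top (hsurj : Function.Surjective f)
    (hf : ∀ ⦃x y⦄, Rel k xi n1 n2 n3 n4 nu gam lam x y → f x = f y) (h2 : (2 : k) ≠ 0) :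
    (powSpan k (f (g k p1)) * powSpan k (f (g k p2)) *
      (List.ofFn fun m => powSpan k (f (g k (E m)))).prod *
      (List.ofFn fun m => powSpan k (f (g k (F m)))).prod *
      (List.ofFn fun m => powSpan k (f (g k (G m)))).prod *
      (List.ofFn fun m => powSpan k (f (g k (H m)))).prod *
      powSpan k (f (g k a)) * powSpan k (f (g k b)) * powSpan k (f (g k c)) *
      powSpan k (f (g k d))) = ⊤ := by
  set l : List A := (vecGens n1 n2 n3 n4).map fun x => f (g k x) with hl
  have hprod : (l.map (powSpan k)).prod = powSpan k (f (g k p1)) * powSpan k (f (g k p2)) *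
      (List.ofFn fun m => powSpan k (f (g k (E m)))).prod *
      (List.ofFn fun m => powSpan k (f (g k (F m)))).prod *
      (List.ofFn fun m => powSpan k (f (g k (G m)))).prod *
      (List.ofFn fun m => powSpan k (f (g k (H m)))).prod := by
    simp [hl, vecGens, List.map_ofFn, Function.comp_def, mul_assoc]
  rw [← hprod]
  set P := (l.map (powSpan k)).prod with hP
  have haa := hf .haa
  have hbb := hf .hbb
  have hcc := hf .hcc
  have hab := hf .hab
  have hac := hf .hac
  have hbc := hf .hbc
  have hdd := hf .hdd
  have hda := hf .hda
  have hdb := hf .hdb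
  have hdc := hf .hdc
  simp only [map_mul, map_one] at haa hbb hcc hab hac hbc hdd hda hdb hdc
  have hz := map_mul_bc hf
  have hvec : ∀ x ∈ l, ∃ y ∈ vecGens n1 n2 n3 n4, f (g k y) = x := by simp [hl]
  have hbz : f (g k c) = f (g k b) * (f (g k b) * f (g k c)) := by
    rw [← mul_assoc, hbb, one_mul]
  set fa := f (g k a)
  set fb := f (g k b)
  set fc := f (g k c)
  set fd := f (g k d)
  set z := fb * fc with hzdef
  have hzz : z * z = 1 := by
    rw [hzdef, mul_assoc, ← mul_assoc fc, ← hbc, mul_assoc, hcc, mul_one, hbb]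
  -- The submodule `powSpan z * P * ⟨a⟩ * ⟨b⟩ * ⟨d⟩` is closed under right multiplication.
  obtain ⟨s0z, s0v⟩ := rightStable_prod_powSpan (K := k) hzz l
    (fun x hx => by obtain ⟨y, -, rfl⟩ := hvec x hx; exact hz y)
    (fun x hx => by obtain ⟨y, hy, rfl⟩ := hvec x hx; exact map_mul_self hf h2 y hy)
    (fun x hx y hy => by
      obtain ⟨u, hu, rfl⟩ := hvec x hx
      obtain ⟨v, hv, rfl⟩ := hvec y hy
      exact map_anticomm hf h2 u hu v hv)
  have s0v' : ∀ x ∈ vecGens n1 n2 n3 n4, RightStable (powSpan k z * P) (f (g k x)) :=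
    fun x hx => s0v _ (List.mem_map_of_mem hx)
  set S0 := powSpan k z * P
  have s1a : RightStable (S0 * powSpan k fa) fa :=
    RightStable.mul_powSpan_self (haa ▸ rightStable_one _)
  have s1z : RightStable (S0 * powSpan k fa) z := s0z.mul_powSpan s0z (hz a)
  have s1v : ∀ x ∈ vecGens n1 n2 n3 n4, RightStable (S0 * powSpan k fa) (f (g k x)) :=
    fun x hx => by
      obtain ⟨t, ht⟩ := map_a_mul hf x hx
      exact (s0v' x hx).mul_powSpan ((s0v' x hx).smul t) ht
  set S1 := S0 * powSpan k fa
  have s2a : RightStable (S1 * powSpan k fb) fa := s1a.mul_powSpan s1a hab.symm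
  have s2z : RightStable (S1 * powSpan k fb) z := s1z.mul_powSpan s1z (hz b)
  have s2b : RightStable (S1 * powSpan k fb) fb :=
    RightStable.mul_powSpan_self (hbb ▸ rightStable_one _)
  have s2c : RightStable (S1 * powSpan k fb) fc := hbz ▸ s2b.mul s2z
  have s2v : ∀ x ∈ vecGens n1 n2 n3 n4, RightStable (S1 * powSpan k fb) (f (g k x)) :=
    fun x hx => (s1v x hx).mul_powSpan ((s1v x hx).smul (-1 : k)) (by
      simpa using map_b_mul hf x hx)
  set S2 := S1 * powSpan k fb
  have htop : S2 * powSpan k fd = ⊤ := by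
    refine eq_top_of_rightStable hsurj ?_ fun x => ?_
    · simpa using Submodule.mul_mem_mul (Submodule.mul_mem_mul (Submodule.mul_mem_mul
        (Submodule.mul_mem_mul (one_mem_powSpan (K := k) z) (one_mem_prod_powSpan l))
        (one_mem_powSpan fa)) (one_mem_powSpan fb)) (one_mem_powSpan (K := k) fd)
    · rcases mem_vecGens x with hx | rfl | rfl | rfl | rfl
      · obtain ⟨t, y, hy, ht⟩ := map_d_mul hf x hx
        exact (s2v x hx).mul_powSpan ((s2v y hy).smul t) ht
      · exact s2a.mul_powSpan s2a hda
      · exact s2b.mul_powSpan s2c hdb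
      · exact s2c.mul_powSpan s2b hdc
      · exact RightStable.mul_powSpan_self (hdd ▸ s2a)
  -- The target submodule is closed under right multiplication by `b * c`, so it contains the above.
  have t1b : RightStable (P * powSpan k fa * powSpan k fb) fb :=
    RightStable.mul_powSpan_self (hbb ▸ rightStable_one _)
  have t2b := t1b.mul_powSpan t1b hbc.symm
  have t2c : RightStable (P * powSpan k fa * powSpan k fb * powSpan k fc) fc :=
    RightStable.mul_powSpan_self (hcc ▸ rightStable_one _)
  have t3z := (t2b.mul_powSpan t2c hdb).mul (t2c.mul_powSpan t2b hdc)
  rw [eq_top_iff, ← htop]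
  have hle : P * powSpan k fa * powSpan k fb * powSpan k fd ≤
      P * powSpan k fa * powSpan k fb * powSpan k fc * powSpan k fd :=
    mul_le_mul_left (le_mul_powSpan _ _) _
  have hcomm (u : A) : u * z = z * u := by
    obtain ⟨w, rfl⟩ := hsurj u
    induction w using FreeAlgebra.induction with
    | grade0 r => rw [AlgHom.commutes, Algebra.commutes]
    | grade1 x => exact hz x
    | mul v w hv hw => rw [map_mul, mul_assoc, hw, ← mul_assoc, hv, mul_assoc]
    | add v w hv hw => rw [map_add, add_mul, hv, hw, mul_add]
  rw [show S2 * powSpan k fd =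
    powSpan k z * (P * powSpan k fa * powSpan k fb * powSpan k fd) by
      simp only [S2, S1, S0, mul_assoc], powSpan, Submodule.mul_le]
  intro p hp q hq
  rw [← powSpan] at hp
  obtain ⟨s, hs, s', hs', rfl⟩ :=
    exists_of_mem_mul_powSpan (S := (1 : Submodule k A)) (by simpa using hp)
  obtain ⟨r, rfl⟩ := Submodule.mem_one.1 hs
  obtain ⟨r', rfl⟩ := Submodule.mem_one.1 hs'
  rw [add_mul, mul_assoc (_ : A) z q, ← hcomm q, ← Algebra.smul_def, ← Algebra.smul_def]
  exact add_mem (Submodule.smul_mem _ _ (hle hq)) (Submodule.smul_mem _ _ (t3z q (hle hq)))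

end Generation

section Representation

open CliffordAlgebra (contractLeft)

variable {R M Γ : Type*} [Field R] [AddCommGroup M] [Module R M]

lemma map_contractLeft (φ : M →ₗ[R] M) (θ θ' : Module.Dual R M) (h : θ' ∘ₗ φ = θ)
    (x : ExteriorAlgebra R M) :
    ExteriorAlgebra.map φ (contractLeft θ x) = contractLeft θ' (ExteriorAlgebra.map φ x) := by
  induction x using CliffordAlgebra.left_induction with
  | algebraMap r =>
    rw [CliffordAlgebra.contractLeft_algebraMap, map_zero]
    erw [AlgHom.commutes, CliffordAlgebra.contractLeft_algebraMap]
  | add x y hx hy => simp only [map_add, hx, hy]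
  | ι_mul x m hx =>
    have hm : θ' (φ m) = θ m := by rw [← h]; rfl
    have h1 := CliffordAlgebra.contractLeft_ι_mul (Q := (0 : QuadraticForm R M)) θ' (φ m)
      (ExteriorAlgebra.map φ x)
    have h2 : ExteriorAlgebra.map φ (CliffordAlgebra.ι 0 m) = CliffordAlgebra.ι 0 (φ m) :=
      ExteriorAlgebra.map_apply_ι φ m
    rw [CliffordAlgebra.contractLeft_ι_mul, map_sub, map_smul, map_mul, map_mul, hx, h2, h1, hm]

/-- Exterior multiplication by `v`, deformed by contraction with `β v` times `1 - σ`. -/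
noncomputable def vecOp (β : M →ₗ[R] Module.Dual R M) (σ : Γ → Γ) (v : M) :
    Module.End R (Γ → ExteriorAlgebra R M) where
  toFun f h := ExteriorAlgebra.ι R v * f h + contractLeft (β v) (f h - f (σ h))
  map_add' f f' := by
    ext h
    simp only [Pi.add_apply, mul_add, map_add, map_sub]
    abel
  map_smul' r f := by
    ext h
    simp [smul_sub]

/-- Substitution along `π` combined with the algebra map induced by `φ`. -/
noncomputable def grpOp (φ : M →ₗ[R] M) (π : Γ → Γ) :
    Module.End R (Γ → ExteriorAlgebra R M) where
  toFun f h := ExteriorAlgebra.map φ (f (π h))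
  map_add' f f' := by ext h; simp
  map_smul' r f := by ext h; simp

lemma grpOp_mul (φ ψ : M →ₗ[R] M) (π ρ : Γ → Γ) :
    grpOp φ π * grpOp ψ ρ = grpOp (φ ∘ₗ ψ) (ρ ∘ π) := by
  ext f h
  simp only [grpOp, Module.End.mul_apply, LinearMap.coe_mk, AddHom.coe_mk, Function.comp_apply]
  rw [← AlgHom.comp_apply, ExteriorAlgebra.map_comp_map]

lemma grpOp_id : grpOp (R := R) (M := M) LinearMap.id (id : Γ → Γ) = 1 := by
  ext f h
  simp [grpOp]

lemma vecOp_smul (β : M →ₗ[R] Module.Dual R M) (σ : Γ → Γ) (r : R) (v : M) :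
    vecOp β σ (r • v) = r • vecOp β σ v := by
  ext f h
  simp [vecOp, smul_add]

lemma vecOp_add (β : M →ₗ[R] Module.Dual R M) (σ : Γ → Γ) (v w : M) :
    vecOp β σ (v + w) = vecOp β σ v + vecOp β σ w := by
  ext f h
  simp only [vecOp, LinearMap.coe_mk, AddHom.coe_mk, LinearMap.add_apply, Pi.add_apply, map_add,
    add_mul]
  abel

lemma vecOp_neg (β : M →ₗ[R] Module.Dual R M) (σ : Γ → Γ) (v : M) :
    vecOp β σ (-v) = -vecOp β σ v := by
  ext f h
  simp only [vecOp, LinearMap.coe_mk, AddHom.coe_mk, LinearMap.neg_apply, Pi.neg_apply, map_neg,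
    neg_mul, neg_add]

lemma grpOp_mul_vecOp (β : M →ₗ[R] Module.Dual R M) (σ π : Γ → Γ) (φ : M →ₗ[R] M) (v : M)
    (hσ : σ ∘ π = π ∘ σ) (hβ : β (φ v) ∘ₗ φ = β v) :
    grpOp φ π * vecOp β σ v = vecOp β σ (φ v) * grpOp φ π := by
  ext f h
  have hσ' : σ (π h) = π (σ h) := congr_fun hσ h
  simp only [grpOp, vecOp, Module.End.mul_apply, LinearMap.coe_mk, AddHom.coe_mk, map_add, map_mul,
    ExteriorAlgebra.map_apply_ι]
  rw [map_contractLeft φ _ _ hβ, map_sub, hσ']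

lemma vecOp_mul_add (β : M →ₗ[R] Module.Dual R M) (σ : Γ → Γ) (hσ : σ ∘ σ = id) (v w : M) :
    vecOp β σ v * vecOp β σ w + vecOp β σ w * vecOp β σ v =
      (β v w + β w v) • (1 - grpOp LinearMap.id σ) := by
  ext f h
  have hσ' : σ (σ h) = h := congr_fun hσ h
  have hc (θ : Module.Dual R M) (u : M) (x : ExteriorAlgebra R M) :
      contractLeft θ (ExteriorAlgebra.ι R u * x) =
        θ u • x - ExteriorAlgebra.ι R u * contractLeft θ x :=
    CliffordAlgebra.contractLeft_ι_mul (Q := (0 : QuadraticForm R M)) θ u x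
  have hvw : ExteriorAlgebra.ι R v * ExteriorAlgebra.ι R w =
      -(ExteriorAlgebra.ι R w * ExteriorAlgebra.ι R v) :=
    eq_neg_of_add_eq_zero_left (ExteriorAlgebra.ι_add_mul_swap v w)
  simp only [grpOp, vecOp, Module.End.mul_apply, LinearMap.add_apply, LinearMap.smul_apply,
    LinearMap.sub_apply, Module.End.one_apply, Pi.add_apply, Pi.sub_apply, Pi.smul_apply,
    LinearMap.coe_mk, AddHom.coe_mk, map_add, map_sub, hc, hσ', ExteriorAlgebra.map_id,
    AlgHom.id_apply, mul_add, mul_sub, ← mul_assoc, hvw]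
  rw [CliffordAlgebra.contractLeft_comm (β v) (β w) (f h),
    CliffordAlgebra.contractLeft_comm (β v) (β w) (f (σ h))]
  simp only [smul_sub, add_smul, neg_mul]
  abel

lemma vecOp_mul_self (β : M →ₗ[R] Module.Dual R M) (σ : Γ → Γ) (hσ : σ ∘ σ = id) (v : M)
    (h2 : (2 : R) ≠ 0) (hv : β v v = 0) : vecOp β σ v * vecOp β σ v = 0 := by
  have h := vecOp_mul_add β σ hσ v v
  rw [hv, add_zero, zero_smul, ← two_smul R] at h
  exact (smul_eq_zero.1 h).resolve_left h2

/-- A subspace of functions closed under all `vecOp`s and containing the vacuum vectors is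
everything. -/
lemma eq_top_of_vecOp_stable [Finite Γ] [DecidableEq Γ] (β : M →ₗ[R] Module.Dual R M) (σ : Γ → Γ)
    (hσ : σ ∘ σ = id) (N : Submodule R (Γ → ExteriorAlgebra R M)) (h1 : ∀ γ, Pi.single γ 1 ∈ N)
    (hN : ∀ v, ∀ f ∈ N, vecOp β σ v f ∈ N) : N = ⊤ := by
  -- Every element lies in a contraction-stable space all of whose translates lie in `N`.
  have key (x : ExteriorAlgebra R M) : ∃ S : Submodule R (ExteriorAlgebra R M), x ∈ S ∧
      (∀ θ, ∀ y ∈ S, contractLeft θ y ∈ S) ∧ ∀ y ∈ S, ∀ γ, Pi.single γ y ∈ N := by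
    induction x using CliffordAlgebra.left_induction with
    | algebraMap r =>
      refine ⟨1, Submodule.algebraMap_mem r, ?_, ?_⟩
      · intro θ y hy
        obtain ⟨s, rfl⟩ := Submodule.mem_one.1 hy
        erw [CliffordAlgebra.contractLeft_algebraMap]
        exact zero_mem _
      · intro y hy γ
        obtain ⟨s, rfl⟩ := Submodule.mem_one.1 hy
        rw [Algebra.algebraMap_eq_smul_one, Pi.single_smul]
        exact N.smul_mem _ (h1 γ)
    | add x y hx hy =>
      obtain ⟨S, hxS, hSc, hSN⟩ := hx
      obtain ⟨S', hyS, hSc', hSN'⟩ := hy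
      refine ⟨S ⊔ S', Submodule.add_mem_sup hxS hyS, fun θ z hz => ?_, fun z hz γ => ?_⟩
      · obtain ⟨s, hs, s', hs', rfl⟩ := Submodule.mem_sup.1 hz
        rw [map_add]
        exact Submodule.add_mem_sup (hSc θ s hs) (hSc' θ s' hs')
      · obtain ⟨s, hs, s', hs', rfl⟩ := Submodule.mem_sup.1 hz
        rw [Pi.single_add]
        exact N.add_mem (hSN s hs γ) (hSN' s' hs' γ)
    | ι_mul x m hx =>
      obtain ⟨S, hxS, hSc, hSN⟩ := hx
      refine ⟨S ⊔ S.map (LinearMap.mulLeft R (ExteriorAlgebra.ι R m)),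
        Submodule.mem_sup_right ⟨x, hxS, rfl⟩, fun θ z hz => ?_, fun z hz γ => ?_⟩
      · obtain ⟨s, hs, _, ⟨s', hs', rfl⟩, rfl⟩ := Submodule.mem_sup.1 hz
        have hc : contractLeft θ (ExteriorAlgebra.ι R m * s') =
            θ m • s' - ExteriorAlgebra.ι R m * contractLeft θ s' :=
          CliffordAlgebra.contractLeft_ι_mul (Q := (0 : QuadraticForm R M)) θ m s'
        rw [map_add, LinearMap.mulLeft_apply, hc, sub_eq_add_neg, ← add_assoc, ← mul_neg]
        exact Submodule.add_mem_sup (S.add_mem (hSc θ s hs) (S.smul_mem _ hs'))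
          ⟨_, S.neg_mem (hSc θ s' hs'), rfl⟩
      · obtain ⟨s, hs, _, ⟨s', hs', rfl⟩, rfl⟩ := Submodule.mem_sup.1 hz
        rw [Pi.single_add]
        refine N.add_mem (hSN s hs γ) ?_
        have hop : Pi.single γ (ExteriorAlgebra.ι R m * s') =
            vecOp β σ m (Pi.single γ s') - Pi.single γ (contractLeft (β m) s')
              + Pi.single (σ γ) (contractLeft (β m) s') := by
          ext δ
          have hδ : σ δ = γ ↔ δ = σ γ := by
            have hσ' (γ : Γ) : σ (σ γ) = γ := congr_fun hσ γ
            constructor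
            · rintro rfl; rw [hσ']
            · rintro rfl; rw [hσ']
          simp only [vecOp, LinearMap.coe_mk, AddHom.coe_mk, Pi.add_apply, Pi.sub_apply,
            Pi.single_apply, hδ]
          split_ifs <;> simp
        rw [LinearMap.mulLeft_apply, hop]
        exact N.add_mem (N.sub_mem (hN m _ (hSN s' hs' γ)) (hSN _ (hSc _ s' hs') γ))
          (hSN _ (hSc _ s' hs') _)
  refine Submodule.eq_top_iff'.2 fun f => ?_
  have := Fintype.ofFinite Γ
  rw [← Finset.univ_sum_single f]
  refine N.sum_mem fun γ _ => ?_
  obtain ⟨S, hS, -, hSN⟩ := key (f γ)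
  exact hSN _ hS γ

lemma finrank_exteriorAlgebra [Module.Finite R M] :
    Module.finrank R (ExteriorAlgebra R M) = 2 ^ Module.finrank R M := by
  rw [Module.finrank_eq_card_basis (Module.finBasis R M).ExteriorAlgebra]
  simp

instance [Module.Finite R M] : Module.Finite R (ExteriorAlgebra R M) :=
  .of_basis (Module.finBasis R M).ExteriorAlgebra

end Representation

section Model

/-- The space spanned by the generators other than `a, b, c, d`. -/
abbrev Vec (k : Type*) (n1 n2 n3 n4 : ℕ) : Type _ :=
  (k × k) × (Fin n1 → k) × (Fin n2 → k) × (Fin n3 → k) × (Fin n4 → k)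

/-- The set on which `a, b, c, d` act regularly: `b ^ x * c ^ y * d ^ t`. -/
abbrev Grp : Type := ZMod 2 × ZMod 2 × ZMod 4

/-- The permutation given by `a`. -/
def permA (h : Grp) : Grp := (h.1, h.2.1, h.2.2 + 2)

/-- The permutation given by `b`. -/
def permB (h : Grp) : Grp := (h.1 + 1, h.2.1, h.2.2)

/-- The permutation given by `c`. -/
def permC (h : Grp) : Grp := (h.1, h.2.1 + 1, h.2.2)

/-- The permutation given by `d`. -/
def permD (h : Grp) : Grp := (h.2.1, h.1, h.2.2 + 1)

variable {n1 n2 n3 n4}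

/-- The bilinear form whose symmetrization gives the anticommutators. -/
noncomputable def form (nu : Matrix (Fin n1) (Fin n4) k) (gam : Matrix (Fin n2) (Fin n3) k)
    (lam : k) : Vec k n1 n2 n3 n4 →ₗ[k] Module.Dual k (Vec k n1 n2 n3 n4) :=
  LinearMap.mk₂ k (fun v w => lam / 2 * (v.1.1 * w.1.2 + v.1.2 * w.1.1) +
      v.2.1 ⬝ᵥ nu.mulVec w.2.2.2.2 + v.2.2.1 ⬝ᵥ gam.mulVec w.2.2.2.1)
    (fun v v' w => by simp; ring) (fun r v w => by simp; ring)
    (fun v w w' => by simp [Matrix.mulVec_add]; ring)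
    (fun r v w => by simp [Matrix.mulVec_smul]; ring)

/-- Conjugation by `a`. -/
def conjA : Vec k n1 n2 n3 n4 →ₗ[k] Vec k n1 n2 n3 n4 where
  toFun v := (v.1, -v.2.1, -v.2.2.1, -v.2.2.2.1, -v.2.2.2.2)
  map_add' v w := by ext <;> simp <;> ring
  map_smul' r v := by ext <;> simp

/-- Conjugation by `d`. -/
def conjD (xi : k) : Vec k n1 n2 n3 n4 →ₗ[k] Vec k n1 n2 n3 n4 where
  toFun v := ((v.1.2, v.1.1), -xi • v.2.1, xi • v.2.2.1, -xi • v.2.2.2.1, xi • v.2.2.2.2)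
  map_add' v w := by ext <;> simp <;> ring
  map_smul' r v := by ext <;> simp <;> ring

/-- The vector corresponding to a generator other than `a, b, c, d`. -/
def genVec : Gen n1 n2 n3 n4 → Vec k n1 n2 n3 n4
  | p1 => ((1, 0), 0, 0, 0, 0)
  | p2 => ((0, 1), 0, 0, 0, 0)
  | E m => (0, Pi.single m 1, 0, 0, 0)
  | F q => (0, 0, Pi.single q 1, 0, 0)
  | G s => (0, 0, 0, Pi.single s 1, 0)
  | H r => (0, 0, 0, 0, Pi.single r 1)
  | _ => 0

/-- The space on which the algebra acts. -/
abbrev Fock (k : Type*) [Field k] (n1 n2 n3 n4 : ℕ) : Type _ :=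
  Grp → ExteriorAlgebra k (Vec k n1 n2 n3 n4)

/-- The operator by which a generator acts. -/
noncomputable def genOp (xi : k) (nu : Matrix (Fin n1) (Fin n4) k)
    (gam : Matrix (Fin n2) (Fin n3) k) (lam : k) :
    Gen n1 n2 n3 n4 → Module.End k (Fock k n1 n2 n3 n4)
  | a => grpOp (conjA k) permA
  | b => grpOp (-LinearMap.id) permB
  | c => grpOp (-LinearMap.id) permC
  | d => grpOp (conjD k xi) permD
  | x => vecOp (form k nu gam lam) (permC ∘ permB) (genVec k x)

variable {k xi nu gam lam}

lemma form_conjA (v : Vec k n1 n2 n3 n4) :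
    form k nu gam lam (conjA k v) ∘ₗ conjA k = form k nu gam lam v := by
  ext <;> simp [form, conjA, Matrix.mulVec_neg]

lemma form_neg (v : Vec k n1 n2 n3 n4) :
    form k nu gam lam ((-LinearMap.id : Vec k n1 n2 n3 n4 →ₗ[k] _) v) ∘ₗ (-LinearMap.id) =
      form k nu gam lam v := by
  ext <;> simp

lemma form_conjD (hxi : xi * xi = -1) (v : Vec k n1 n2 n3 n4) :
    form k nu gam lam (conjD k xi v) ∘ₗ conjD k xi = form k nu gam lam v := by
  refine LinearMap.ext fun w => ?_
  simp only [form, conjD, LinearMap.comp_apply, LinearMap.coe_mk, AddHom.coe_mk,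
    LinearMap.mk₂_apply, Matrix.mulVec_smul, dotProduct_smul, smul_dotProduct, smul_eq_mul]
  linear_combination (-(v.2.1 ⬝ᵥ nu.mulVec w.2.2.2.2) - v.2.2.1 ⬝ᵥ gam.mulVec w.2.2.2.1) * hxi

set_option maxHeartbeats 1000000 in
lemma genOp_rel (hxi : xi * xi = -1) (h2 : (2 : k) ≠ 0)
    ⦃x y : FreeAlgebra k (Gen n1 n2 n3 n4)⦄ (h : Rel k xi n1 n2 n3 n4 nu gam lam x y) :
    FreeAlgebra.lift k (genOp k xi nu gam lam) x = FreeAlgebra.lift k (genOp k xi nu gam lam) y := by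
  have hσ : (permC ∘ permB) ∘ (permC ∘ permB) = id := by decide
  have hbc : grpOp (-LinearMap.id : Vec k n1 n2 n3 n4 →ₗ[k] _) permB * grpOp (-LinearMap.id) permC =
      grpOp LinearMap.id (permC ∘ permB) := by
    rw [grpOp_mul]; congr 1; ext <;> simp
  have ha (v : Vec k n1 n2 n3 n4) := grpOp_mul_vecOp (form k nu gam lam) (permC ∘ permB) permA
    (conjA k) v (by decide) (form_conjA v)
  have hb (v : Vec k n1 n2 n3 n4) := grpOp_mul_vecOp (form k nu gam lam) (permC ∘ permB) permB
    (-LinearMap.id) v (by decide) (form_neg v)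
  have hc (v : Vec k n1 n2 n3 n4) := grpOp_mul_vecOp (form k nu gam lam) (permC ∘ permB) permC
    (-LinearMap.id) v (by decide) (form_neg v)
  have hd (v : Vec k n1 n2 n3 n4) := grpOp_mul_vecOp (form k nu gam lam) (permC ∘ permB) permD
    (conjD k xi) v (by decide) (form_conjD hxi v)
  have hvv (v w : Vec k n1 n2 n3 n4) (t : k)
      (ht : form k nu gam lam v w + form k nu gam lam w v = t) :=
    ht ▸ vecOp_mul_add (form k nu gam lam) (permC ∘ permB) hσ v w
  have hsq (v : Vec k n1 n2 n3 n4) := vecOp_mul_self (form k nu gam lam) (permC ∘ permB) hσ v h2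
  have hzero (v w : Vec k n1 n2 n3 n4)
      (ht : form k nu gam lam v w + form k nu gam lam w v = 0) :=
    (hvv v w 0 ht).trans (zero_smul k _)
  have hgrp {φ ψ φ' ψ' : Vec k n1 n2 n3 n4 →ₗ[k] Vec k n1 n2 n3 n4} {π τ π' τ' : Grp → Grp}
      (h : φ ∘ₗ ψ = φ' ∘ₗ ψ') (h' : τ ∘ π = τ' ∘ π') :
      grpOp φ π * grpOp ψ τ = grpOp φ' π' * grpOp ψ' τ' := by
    rw [grpOp_mul, grpOp_mul, h, h']
  have hgrp1 {φ ψ χ : Vec k n1 n2 n3 n4 →ₗ[k] Vec k n1 n2 n3 n4} {π τ υ : Grp → Grp}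
      (h : φ ∘ₗ ψ = χ) (h' : τ ∘ π = υ) : grpOp φ π * grpOp ψ τ = grpOp χ υ := by
    rw [grpOp_mul, h, h']
  have hneg {T : Module.End k (Fock k n1 n2 n3 n4)} {v w : Vec k n1 n2 n3 n4}
      (h : T * vecOp (form k nu gam lam) (permC ∘ permB) v =
        vecOp (form k nu gam lam) (permC ∘ permB) w * T) (hw : w = -v) :
      T * vecOp (form k nu gam lam) (permC ∘ permB) v =
        -(vecOp (form k nu gam lam) (permC ∘ permB) v * T) := by
    rw [h, hw, vecOp_neg]
    rfl
  have hsmul {T : Module.End k (Fock k n1 n2 n3 n4)} {v w : Vec k n1 n2 n3 n4} {r : k}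
      (h : T * vecOp (form k nu gam lam) (permC ∘ permB) v =
        vecOp (form k nu gam lam) (permC ∘ permB) w * T) (hw : w = r • v) :
      T * vecOp (form k nu gam lam) (permC ∘ permB) v =
        r • (vecOp (form k nu gam lam) (permC ∘ permB) v * T) := by
    rw [h, hw, vecOp_smul, smul_mul_assoc]
  have hnegsmul {T : Module.End k (Fock k n1 n2 n3 n4)} {v w : Vec k n1 n2 n3 n4} {r : k}
      (h : T * vecOp (form k nu gam lam) (permC ∘ permB) v =
        vecOp (form k nu gam lam) (permC ∘ permB) w * T) (hw : w = -(r • v)) :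
      T * vecOp (form k nu gam lam) (permC ∘ permB) v =
        -(r • (vecOp (form k nu gam lam) (permC ∘ permB) v * T)) := by
    rw [h, hw, vecOp_neg, vecOp_smul]
    rfl
  have hAA : conjA k ∘ₗ conjA k = (LinearMap.id : Vec k n1 n2 n3 n4 →ₗ[k] _) := by
    ext <;> simp [conjA]
  have hDD : conjD k xi ∘ₗ conjD k xi = (conjA k : Vec k n1 n2 n3 n4 →ₗ[k] _) := by
    refine LinearMap.ext fun v => ?_
    simp [conjD, conjA, smul_smul, hxi]
  have hDA : conjD k xi ∘ₗ conjA k = (conjA k ∘ₗ conjD k xi : Vec k n1 n2 n3 n4 →ₗ[k] _) := by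
    refine LinearMap.ext fun v => ?_
    simp [conjD, conjA]
  cases h <;> simp only [g, map_mul, map_add, map_sub, map_one, map_neg, map_smul, map_zero,
    FreeAlgebra.lift_ι_apply, genOp]
  case haa => exact (hgrp1 hAA (by decide)).trans grpOp_id
  case hbb => exact (hgrp1 (by simp) (by decide)).trans grpOp_id
  case hcc => exact (hgrp1 (by simp) (by decide)).trans grpOp_id
  case hab => exact hgrp (by simp) (by decide)
  case hac => exact hgrp (by simp) (by decide)
  case hbc => exact hgrp rfl (by decide)
  case hdd => exact hgrp1 hDD (by decide)
  case hda => exact hgrp hDA (by decide)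
  case hdb => exact hgrp (by simp) (by decide)
  case hdc => exact hgrp (by simp) (by decide)
  case aE | aF | aG | aH => exact hneg (ha _) (by simp [conjA, genVec])
  case bE | bF | bG | bH | bp1 | bp2 => exact hneg (hb _) (by simp)
  case cE | cF | cG | cH | cp1 | cp2 => exact hneg (hc _) (by simp)
  case dE | dG => exact hnegsmul (hd _) (by simp [conjD, genVec])
  case dF | dH => exact hsmul (hd _) (by simp [conjD, genVec])
  case ap1 => exact (ha _).trans (by simp [conjA, genVec])
  case ap2 => exact (ha _).trans (by simp [conjA, genVec])
  case dp1 => exact (hd _).trans (by simp [conjD, genVec])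
  case dp2 => exact (hd _).trans (by simp [conjD, genVec])
  case p1p1 => exact hsq _ (by simp [form, genVec])
  case p2p2 => exact hsq _ (by simp [form, genVec])
  case p1p2 =>
    have hlam : lam / 2 + lam / 2 = lam := by
      rw [← two_mul, ← mul_div_assoc, mul_div_cancel_left₀ _ h2]
    rw [hbc]
    exact hvv _ _ _ (by simp [form, genVec, hlam])
  case EH => rw [hbc]; exact hvv _ _ _ (by simp [form, genVec])
  case FG => rw [hbc]; exact hvv _ _ _ (by simp [form, genVec])
  all_goals exact hzero _ _ (by simp [form, genVec])

/-- The exponent vectors of the monomials. -/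
abbrev Exps (n1 n2 n3 n4 : ℕ) : Type :=
  (Fin 2 × Fin 2) × (Fin n1 → Fin 2) × (Fin n2 → Fin 2) × (Fin n3 → Fin 2) ×
    (Fin n4 → Fin 2) × Fin 2 × Fin 2 × Fin 2 × Fin 2

lemma card_exps : Fintype.card (Exps n1 n2 n3 n4) = 2 ^ (6 + (n1 + n2 + n3 + n4)) := by
  simp only [Exps, Fintype.card_prod, Fintype.card_fin, Fintype.card_pi, Finset.prod_const,
    Finset.card_univ]
  ring

variable (k) in
lemma finrank_fock : Module.finrank k (Fock k n1 n2 n3 n4) = 2 ^ (6 + (n1 + n2 + n3 + n4)) := by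
  rw [Module.finrank_pi_fintype]
  simp only [finrank_exteriorAlgebra, Module.finrank_prod, Module.finrank_self,
    Module.finrank_fin_fun, Finset.sum_const, Finset.card_univ, Fintype.card_prod, ZMod.card,
    smul_eq_mul]
  ring

/-- The monomial with given exponents, in the free algebra. -/
noncomputable def word (x : Exps n1 n2 n3 n4) : FreeAlgebra k (Gen n1 n2 n3 n4) :=
  match x with
  | ⟨⟨i, j⟩, eE, eF, eG, eH, ea, eb, ec, ed⟩ =>
    g k p1 ^ i.val * g k p2 ^ j.val *
      (List.ofFn fun m => g k (E m) ^ (eE m).val).prod *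
      (List.ofFn fun q => g k (F q) ^ (eF q).val).prod *
      (List.ofFn fun s => g k (G s) ^ (eG s).val).prod *
      (List.ofFn fun r => g k (H r) ^ (eH r).val).prod *
      g k a ^ ea.val * g k b ^ eb.val * g k c ^ ec.val * g k d ^ ed.val

variable {A : Type*} [Ring A] [Algebra k A] {f : FreeAlgebra k (Gen n1 n2 n3 n4) →ₐ[k] A}

lemma span_range_word_eq_top (hsurj : Function.Surjective f)
    (hf : ∀ ⦃x y⦄, Rel k xi n1 n2 n3 n4 nu gam lam x y → f x = f y) (h2 : (2 : k) ≠ 0) :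
    Submodule.span k (Set.range fun x => f (word (k := k) x)) = ⊤ := by
  rw [eq_top_iff, ← prod_powSpan_eq_top hsurj hf h2]
  simp only [prod_ofFn_powSpan]
  simp only [powSpan, span_range_mul_span_range]
  refine Submodule.span_mono ?_
  rintro _ ⟨⟨⟨⟨⟨⟨⟨⟨⟨⟨i, j⟩, eE⟩, eF⟩, eG⟩, eH⟩, ea⟩, eb⟩, ec⟩, ed⟩, rfl⟩
  exact ⟨((i, j), eE, eF, eG, eH, ea, eb, ec, ed), by
    simp [word, map_list_prod, List.map_ofFn, Function.comp_def]⟩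

lemma grpOp_single {R M Γ : Type*} [Field R] [AddCommGroup M] [Module R M] [DecidableEq Γ]
    (φ : M →ₗ[R] M) {π : Γ → Γ} (hπ : Function.Injective π) (h : Γ) :
    grpOp φ π (Pi.single (π h) 1) = Pi.single h 1 := by
  ext h'
  simp only [grpOp, LinearMap.coe_mk, AddHom.coe_mk, Pi.single_apply, hπ.eq_iff]
  split_ifs <;> simp

/-- The vacuum vector is cyclic. -/
lemma genOp_cyclic (N : Submodule k (Fock k n1 n2 n3 n4)) (h0 : Pi.single 0 1 ∈ N)
    (hN : ∀ x, ∀ v ∈ N, genOp k xi nu gam lam x v ∈ N) : N = ⊤ := by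
  have iter (φ : Vec k n1 n2 n3 n4 →ₗ[k] Vec k n1 n2 n3 n4) (π : Grp → Grp)
      (hπ : Function.Injective π) (hφ : ∀ v ∈ N, grpOp φ π v ∈ N) (n : ℕ) (h : Grp)
      (hh : Pi.single (π^[n] h) 1 ∈ N) : Pi.single h 1 ∈ N := by
    induction n generalizing h with
    | zero => exact hh
    | succ n ih => exact grpOp_single φ hπ h ▸ hφ _ (ih _ hh)
  refine eq_top_of_vecOp_stable (form k nu gam lam) (permC ∘ permB) (by decide) N (fun h => ?_) ?_
  · obtain ⟨i, j, l, hijl⟩ : ∃ i j : Fin 2, ∃ l : Fin 4,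
        permB^[i.val] (permC^[j.val] (permD^[l.val] h)) = 0 := by
      revert h
      decide
    exact iter _ permD (by decide) (hN d) l _ <| iter _ permC (by decide) (hN c) j _ <|
      iter _ permB (by decide) (hN b) i _ (hijl ▸ h0)
  · intro v w hw
    have hv : v = v.1.1 • genVec k p1 + v.1.2 • genVec k p2 + ∑ m, v.2.1 m • genVec k (E m) +
        ∑ q, v.2.2.1 q • genVec k (F q) + ∑ s, v.2.2.2.1 s • genVec k (G s) +
        ∑ r, v.2.2.2.2 r • genVec k (H r) := by
      ext <;> simp [genVec, Prod.fst_sum, Prod.snd_sum, Pi.single_apply]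
    let L : Submodule k (Vec k n1 n2 n3 n4) :=
      { carrier := {v | vecOp (form k nu gam lam) (permC ∘ permB) v w ∈ N}
        zero_mem' := by
          have := vecOp_smul (form k nu gam lam) (permC ∘ permB) 0 0
          rw [zero_smul, zero_smul] at this
          simp [this]
        add_mem' := fun {u v} hu hv => by
          rw [Set.mem_ofPred_eq, vecOp_add]
          exact N.add_mem hu hv
        smul_mem' := fun r v hv => by
          rw [Set.mem_ofPred_eq, vecOp_smul]
          exact N.smul_mem r hv }
    have hL : ∀ x, genOp k xi nu gam lam x = vecOp (form k nu gam lam) (permC ∘ permB) (genVec k x) →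
        genVec k x ∈ L := fun x hx => by
      have := hN x w hw
      rwa [hx] at this
    change v ∈ L
    rw [hv]
    exact L.add_mem (L.add_mem (L.add_mem (L.add_mem (L.add_mem (L.smul_mem _ (hL p1 rfl))
      (L.smul_mem _ (hL p2 rfl))) (L.sum_mem fun m _ => L.smul_mem _ (hL (E m) rfl)))
      (L.sum_mem fun q _ => L.smul_mem _ (hL (F q) rfl)))
      (L.sum_mem fun s _ => L.smul_mem _ (hL (G s) rfl)))
      (L.sum_mem fun r _ => L.smul_mem _ (hL (H r) rfl))

lemma finrank_and_basis (hsurj : Function.Surjective f)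
    (hf : ∀ ⦃x y⦄, Rel k xi n1 n2 n3 n4 nu gam lam x y → f x = f y) (h2 : (2 : k) ≠ 0)
    (ρ : A →ₐ[k] Module.End k (Fock k n1 n2 n3 n4))
    (hρ : ∀ x, ρ (f (g k x)) = genOp k xi nu gam lam x) :
    Module.finrank k A = 2 ^ (6 + (n1 + n2 + n3 + n4)) ∧
    LinearIndependent k (fun x => f (word (k := k) x)) ∧
    Submodule.span k (Set.range fun x => f (word (k := k) x)) = ⊤ := by
  have hspan := span_range_word_eq_top hsurj hf h2
  have : Module.Finite k A :=
    Module.finite_def.2 (hspan ▸ Submodule.fg_span (Set.finite_range _))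
  have hle : Module.finrank k A ≤ 2 ^ (6 + (n1 + n2 + n3 + n4)) := by
    rw [← card_exps, ← finrank_top k A, ← hspan]
    exact finrank_range_le_card _
  let T : A →ₗ[k] Fock k n1 n2 n3 n4 := LinearMap.applyₗ (Pi.single 0 1) ∘ₗ ρ.toLinearMap
  have hT : LinearMap.range T = ⊤ := by
    refine genOp_cyclic (xi := xi) (nu := nu) (gam := gam) (lam := lam) _ ⟨1, by simp [T]⟩ ?_
    rintro x _ ⟨u, rfl⟩
    exact ⟨f (g k x) * u, by simp [T, hρ]⟩
  have hge := T.finrank_le_finrank_of_surjective (LinearMap.range_eq_top.1 hT)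
  rw [finrank_fock] at hge
  have heq := le_antisymm hle hge
  exact ⟨heq, linearIndependent_of_top_le_span_of_card_eq_finrank hspan.ge
    (by rw [heq, card_exps]), hspan⟩

end Model

theorem thm [IsAlgClosed k] [CharZero k] (xi : k) (hxi : IsPrimitiveRoot xi 4)
    (n1 n2 n3 n4 : ℕ) (nu : Matrix (Fin n1) (Fin n4) k)
    (gam : Matrix (Fin n2) (Fin n3) k) (lam : k) :
    Module.finrank k (U k xi n1 n2 n3 n4 nu gam lam) = 2 ^ (6 + (n1 + n2 + n3 + n4)) ∧
    LinearIndependent k (mono k xi n1 n2 n3 n4 nu gam lam) ∧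
    Submodule.span k (Set.range (mono k xi n1 n2 n3 n4 nu gam lam)) = ⊤ := by
  have h2 : (2 : k) ≠ 0 := two_ne_zero
  have hxi' : xi * xi = -1 := by
    have h4 : (xi * xi - 1) * (xi * xi + 1) = 0 := by
      linear_combination hxi.pow_eq_one
    rcases mul_eq_zero.1 h4 with h | h
    · exact absurd (by linear_combination h) (hxi.pow_ne_one_of_pos_of_lt two_ne_zero (by norm_num))
    · linear_combination h
  let ρ : U k xi n1 n2 n3 n4 nu gam lam →ₐ[k] Module.End k (Fock k n1 n2 n3 n4) :=
    RingQuot.liftAlgHom k ⟨FreeAlgebra.lift k (genOp k xi nu gam lam), genOp_rel hxi' h2⟩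
  have hmono : mono k xi n1 n2 n3 n4 nu gam lam =
      fun x => mk k xi n1 n2 n3 n4 nu gam lam (word x) := rfl
  rw [hmono]
  exact finrank_and_basis (RingQuot.mkAlgHom_surjective k _)
    (fun _ _ h => RingQuot.mkAlgHom_rel k h) h2 ρ
    fun x => (RingQuot.liftAlgHom_mkAlgHom_apply k _ _ _).trans (FreeAlgebra.lift_ι_apply _ _)

end Stmt4
end
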